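/- arXiv:0707.3244 — 4 statements merged into one kernel-verified Lean document; each statement's English description precedes it below -/
import Mathlib

section
/- For all positive integers m and n, the shuffle-sum of multiple zeta values ζ({2}^m ⧢ {3,1}^n) — that is, the sum of ζ(w) over all shuffles w of the list {2}^m with the list {3,1}^n, counted with multiplicity — equals binom(2n+m, m) · π^(4n+2m) / ((2n+1)·(4n+2m+1)!). -/
/-- The multiple zeta value `ζ(s₁,…,s_d) = ∑_{k₁ > k₂ > ⋯ > k_d ≥ 1} 1/(k₁^{s₁} ⋯ k_d^{s_d})`. -/
noncomputable def mzv (s : List ℕ) : ℝ :=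
  ∑' k : {k : Fin s.length → ℕ // StrictAnti k ∧ ∀ i, 0 < k i},
    ∏ i, 1 / ((k.1 i : ℝ) ^ s.get i)

/-- The list of all shuffles (interleavings) of two lists, with multiplicity. -/
def listShuffles {α : Type*} : List α → List α → List (List α)
  | [], v => [v]
  | u, [] => [u]
  | a :: u, b :: v =>
      ((listShuffles u (b :: v)).map (a :: ·)) ++ ((listShuffles (a :: u) v).map (b :: ·))

/-- `ζ(u ⧢ v)`: the sum of `ζ(w)` over all shuffles `w` of `u` and `v`, with multiplicity. -/
noncomputable def zetaShuffle (u v : List ℕ) : ℝ :=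
  ((listShuffles u v).map mzv).sum

noncomputable def mzT : ℕ → List ℕ → ℝ
  | _, [] => 1
  | 0, _ :: _ => 0
  | N + 1, a :: s => mzT N (a :: s) + mzT N s / ((N : ℝ) + 1) ^ a

def TS (N d : ℕ) : Finset (Fin d → ℕ) :=
  {k ∈ Fintype.piFinset (fun _ : Fin d => Finset.Icc 1 N) | ∀ i j : Fin d, i < j → k j < k i}

lemma mem_TS {N d : ℕ} {k : Fin d → ℕ} :
    k ∈ TS N d ↔ (∀ i, 1 ≤ k i ∧ k i ≤ N) ∧ ∀ i j : Fin d, i < j → k j < k i := by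
  simp [TS, Fintype.mem_piFinset]

lemma mzT_eq (N : ℕ) : ∀ s : List ℕ,
    ∑ k ∈ TS N s.length, ∏ i, 1 / ((k i : ℝ) ^ s.get i) = mzT N s := by
  induction N with
  | zero =>
    intro s
    cases s with
    | nil =>
      have : TS 0 ([] : List ℕ).length = {Fin.elim0} := by
        ext k; simp only [mem_TS, Finset.mem_singleton]
        exact ⟨fun _ => funext fun i => i.elim0, fun _ => ⟨fun i => i.elim0, fun i => i.elim0⟩⟩
      rw [this]; simp [mzT]
    | cons a s =>
      rw [mzT]
      apply Finset.sum_eq_zero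
      intro k hk
      have := (mem_TS.1 hk).1 ⟨0, by simp⟩
      omega
  | succ N ih =>
    intro s
    cases s with
    | nil =>
      have : TS (N+1) ([] : List ℕ).length = {Fin.elim0} := by
        ext k; simp only [mem_TS, Finset.mem_singleton]
        exact ⟨fun _ => funext fun i => i.elim0, fun _ => ⟨fun i => i.elim0, fun i => i.elim0⟩⟩
      rw [this]; simp [mzT]
    | cons a s =>
      rw [mzT, ← ih, ← ih, ← Finset.sum_filter_not_add_sum_filter (TS (N+1) (a :: s).length)
        (fun k => k ⟨0, by simp⟩ = N + 1)]
      congr 1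
      · apply Finset.sum_congr _ (fun _ _ => rfl)
        ext k
        simp only [Finset.mem_filter, mem_TS]
        constructor
        · rintro ⟨⟨h1, h2⟩, h3⟩
          refine ⟨fun i => ⟨(h1 i).1, ?_⟩, h2⟩
          have h0 := h1 ⟨0, by simp⟩
          rcases eq_or_ne i ⟨0, by simp⟩ with h | h
          · subst h; omega
          · have := h2 ⟨0, by simp⟩ i (by
              rw [Fin.lt_def]; simp; rcases Nat.eq_zero_or_pos i.1 with h' | h'
              · exact absurd (Fin.ext h') h
              · exact h')
            omega
        · rintro ⟨h1, h2⟩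
          refine ⟨⟨fun i => ⟨(h1 i).1, by have := (h1 i).2; omega⟩, h2⟩, ?_⟩
          have := (h1 ⟨0, by simp⟩).2
          omega
      · rw [Finset.sum_div]
        symm
        refine Finset.sum_bij' (fun (k : Fin s.length → ℕ) _ => (Fin.cons (N+1) k : Fin (s.length + 1) → ℕ))
          (fun (k : Fin (s.length + 1) → ℕ) _ => Fin.tail k) ?_ ?_ ?_ ?_ ?_
        · intro k hk
          rw [mem_TS] at hk
          simp only [Finset.mem_filter, mem_TS]
          refine ⟨⟨?_, ?_⟩, rfl⟩
          · intro i
            refine Fin.cases (by simp) (fun i => ?_) i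
            have := hk.1 i
            simp only [Fin.cons_succ]; omega
          · intro i j
            refine Fin.cases ?_ (fun i => ?_) i <;> refine Fin.cases ?_ (fun j => ?_) j
            · intro h; exact absurd h (lt_irrefl _)
            · intro _
              have := hk.1 j
              simp only [Fin.cons_succ, Fin.cons_zero]; omega
            · intro h; exact absurd h (by simp [Fin.lt_def])
            · intro h
              simp only [Fin.cons_succ]
              exact hk.2 i j (by simpa using h)
        · intro k hk
          simp only [Finset.mem_filter, mem_TS] at hk
          obtain ⟨⟨h1, h2⟩, h3⟩ := hk
          rw [mem_TS]
          refine ⟨fun i => ⟨(h1 i.succ).1, ?_⟩, fun i j hij => h2 i.succ j.succ (by simpa using hij)⟩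
          have := h2 ⟨0, by simp⟩ i.succ (by simp [Fin.lt_def])
          rw [h3] at this
          exact Nat.lt_succ_iff.1 this
        · intro k hk; simp
        · intro k hk
          have h3 := (Finset.mem_filter.1 hk).2
          conv_rhs => rw [← Fin.cons_self_tail k]
          congr 1
          exact h3.symm
        · intro k hk
          change _ = ∏ i : Fin (s.length + 1), _
          rw [Fin.prod_univ_succ]
          simp
          rw [div_eq_inv_mul]

lemma mzT_nonneg (N : ℕ) (s : List ℕ) : 0 ≤ mzT N s := by
  rw [← mzT_eq]; positivity

lemma mzT_mono (s : List ℕ) : Monotone (fun N => mzT N s) := by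
  apply monotone_nat_of_le_succ
  intro N
  cases s with
  | nil => simp [mzT]
  | cons a s =>
    simp only [mzT]
    have := mzT_nonneg N s
    have : 0 ≤ mzT N s / ((N : ℝ) + 1) ^ a := by positivity
    linarith

lemma mzv_eq_of_tendsto (s : List ℕ) (c : ℝ) (h : Filter.Tendsto (fun N => mzT N s) Filter.atTop (nhds c)) :
    mzv s = c := by
  classical
  have hle : ∀ N, mzT N s ≤ c := (mzT_mono s).ge_of_tendsto h
  set f : {k : Fin s.length → ℕ // StrictAnti k ∧ ∀ i, 0 < k i} → ℝ :=
    fun k => ∏ i, 1 / ((k.1 i : ℝ) ^ s.get i) with hf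
  have hf0 : ∀ k, 0 ≤ f k := fun k => by simp only [hf]; positivity
  have hmem : ∀ N, ∀ k ∈ TS N s.length, StrictAnti k ∧ ∀ i, 0 < k i := by
    intro N k hk
    rw [mem_TS] at hk
    exact ⟨fun i j hij => hk.2 i j hij, fun i => (hk.1 i).1⟩
  have hT : ∀ N, ∑ k ∈ (TS N s.length).subtype (fun k => StrictAnti k ∧ ∀ i, 0 < k i), f k = mzT N s := by
    intro N
    rw [← mzT_eq]
    exact Finset.sum_subtype_of_mem (fun k : Fin s.length → ℕ => ∏ i, 1 / ((k i : ℝ) ^ s.get i)) (hmem N)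
  have hS : HasSum f c := by
    apply hasSum_of_isLUB_of_nonneg _ hf0
    constructor
    · rintro _ ⟨u, rfl⟩
      set N := ∑ k ∈ u, ∑ i, k.1 i
      refine le_trans ?_ (hle N)
      rw [← hT]
      apply Finset.sum_le_sum_of_subset_of_nonneg
      · intro k hk
        rw [Finset.mem_subtype, mem_TS]
        refine ⟨fun i => ⟨k.2.2 i, ?_⟩, fun i j hij => k.2.1 hij⟩
        calc k.1 i ≤ ∑ i, k.1 i := Finset.single_le_sum (f := fun i => k.1 i) (fun _ _ => Nat.zero_le _) (Finset.mem_univ i)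
          _ ≤ N := Finset.single_le_sum (f := fun k : {k : Fin s.length → ℕ // StrictAnti k ∧ ∀ i, 0 < k i} => ∑ i, k.1 i) (fun _ _ => Nat.zero_le _) hk
      · intro k _ _; exact hf0 k
    · intro b hb
      apply le_of_tendsto' h
      intro N
      rw [← hT]
      exact hb ⟨_, rfl⟩
  exact hS.tsum_eq

noncomputable def Sh (N : ℕ) (u v : List ℕ) : ℝ := ((listShuffles u v).map (mzT N)).sum

lemma sum_map_cons (N a : ℕ) (L : List (List ℕ)) :
    ((L.map (a :: ·)).map (mzT (N+1))).sum
      = ((L.map (a :: ·)).map (mzT N)).sum + (L.map (mzT N)).sum / ((N:ℝ)+1)^a := by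
  induction L with
  | nil => simp
  | cons l L ih => 
    simp only [List.map_cons, List.sum_cons] at ih ⊢
    rw [ih, mzT]; ring

lemma Sh_nil_nil (N : ℕ) : Sh N [] [] = 1 := by simp [Sh, listShuffles, mzT]
lemma Sh_nil_cons (N b : ℕ) (v : List ℕ) :
    Sh (N+1) [] (b :: v) = Sh N [] (b :: v) + Sh N [] v / ((N:ℝ)+1)^b := by
  simp [Sh, listShuffles, mzT]
lemma Sh_cons_nil (N a : ℕ) (u : List ℕ) :
    Sh (N+1) (a :: u) [] = Sh N (a :: u) [] + Sh N u [] / ((N:ℝ)+1)^a := by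
  cases u <;> simp [Sh, listShuffles, mzT]
lemma Sh_cons_cons (N a b : ℕ) (u v : List ℕ) :
    Sh (N+1) (a :: u) (b :: v) = Sh N (a :: u) (b :: v) + Sh N u (b :: v) / ((N:ℝ)+1)^a
      + Sh N (a :: u) v / ((N:ℝ)+1)^b := by
  simp only [Sh]
  rw [listShuffles, List.map_append, List.map_append, List.sum_append, List.sum_append,
    sum_map_cons, sum_map_cons]
  ring

noncomputable def ZA (N m n : ℕ) : ℝ := Sh N (List.replicate m 2) (List.flatten (List.replicate n [3, 1]))
noncomputable def ZB (N m n : ℕ) : ℝ := Sh N (List.replicate m 2) (1 :: List.flatten (List.replicate n [3, 1]))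

lemma Sh_nonneg (N : ℕ) (u v : List ℕ) : 0 ≤ Sh N u v := by
  apply List.sum_nonneg
  intro x hx
  obtain ⟨w, _, rfl⟩ := List.mem_map.1 hx
  exact mzT_nonneg _ _
lemma ZA_nonneg (N m n : ℕ) : 0 ≤ ZA N m n := Sh_nonneg _ _ _
lemma Sh_mono (u v : List ℕ) : Monotone (fun N => Sh N u v) := by
  intro N N' h
  apply List.sum_le_sum
  intro w _
  exact mzT_mono w h

lemma Sh_zero_cons (u v : List ℕ) (b : ℕ) : Sh 0 u (b :: v) = 0 := by
  cases u with
  | nil => simp [Sh, listShuffles, mzT]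
  | cons a u => 
    have (c : ℕ) (L : List (List ℕ)) : ((L.map (c :: ·)).map (mzT 0)).sum = 0 := by
      induction L with
      | nil => simp
      | cons l L ih => simpa [mzT] using ih
    rw [Sh, listShuffles, List.map_append, List.sum_append, this, this, add_zero]

lemma ZA_zero (m n : ℕ) : ZA 0 m n = if (m, n) = (0, 0) then 1 else 0 := by
  cases n with
  | zero => cases m <;> simp [ZA, Sh, listShuffles, mzT, List.replicate_succ]
  | succ n => simp [ZA, List.replicate_succ, Sh_zero_cons]
lemma ZB_zero (m n : ℕ) : ZB 0 m n = 0 := by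
  simp [ZB, Sh_zero_cons]

lemma ZA_succ (N m n : ℕ) : ZA (N+1) m n = ZA N m n
    + (if m = 0 then 0 else ZA N (m-1) n) / ((N:ℝ)+1)^2
    + (if n = 0 then 0 else ZB N m (n-1)) / ((N:ℝ)+1)^3 := by
  cases m <;> cases n <;>
    simp [ZA, ZB, List.replicate_succ, Sh_nil_nil, Sh_nil_cons, Sh_cons_nil, Sh_cons_cons]
lemma ZB_succ (N m n : ℕ) : ZB (N+1) m n = ZB N m n
    + (if m = 0 then 0 else ZB N (m-1) n) / ((N:ℝ)+1)^2
    + ZA N m n / ((N:ℝ)+1) := by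
  cases m <;> 
    simp [ZA, ZB, List.replicate_succ, Sh_nil_cons, Sh_cons_cons]

lemma tendsto_list_sum_aux (L : List (List ℕ)) (B : ℝ)
    (h : ∀ N, (L.map (mzT N)).sum ≤ B) :
    Filter.Tendsto (fun N => (L.map (mzT N)).sum) Filter.atTop (nhds ((L.map mzv).sum)) := by
  induction L with
  | nil => simp
  | cons w L ih =>
    simp only [List.map_cons, List.sum_cons] at h ⊢
    have h1 : ∀ N, 0 ≤ (L.map (mzT N)).sum := fun N => by
      apply List.sum_nonneg
      intro x hx
      obtain ⟨w, _, rfl⟩ := List.mem_map.1 hx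
      exact mzT_nonneg _ _
    refine Filter.Tendsto.add ?_ (ih fun N => by have := h N; have := mzT_nonneg N w; linarith)
    have h2 := tendsto_atTop_ciSup (mzT_mono w) ⟨B, by
      rintro _ ⟨N, rfl⟩; have := h N; have := h1 N; simp only; linarith⟩
    rwa [← mzv_eq_of_tendsto w _ h2] at h2

lemma tendsto_ZA (m n : ℕ) (B : ℝ) (h : ∀ N, ZA N m n ≤ B) :
    Filter.Tendsto (fun N => ZA N m n) Filter.atTop
      (nhds (zetaShuffle (List.replicate m 2) (List.flatten (List.replicate n [3, 1])))) :=
  tendsto_list_sum_aux _ B h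

noncomputable def pq (x y : ℝ) : ℕ → ℝ × ℝ
  | 0 => (1, 0)
  | N + 1 => ((pq x y N).1 + x * (pq x y N).1 / ((N:ℝ)+1)^2 + (pq x y N).2 / ((N:ℝ)+1)^3,
      (pq x y N).2 + x * (pq x y N).2 / ((N:ℝ)+1)^2 + y * (pq x y N).1 / ((N:ℝ)+1))

noncomputable def th (f : PowerSeries ℝ) : PowerSeries ℝ := PowerSeries.X * PowerSeries.derivative ℝ f

lemma coeff_th (f : PowerSeries ℝ) (n : ℕ) : PowerSeries.coeff n (th f) = n * PowerSeries.coeff n f := by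
  cases n with
  | zero => simp [th]
  | succ n => rw [th, PowerSeries.coeff_succ_X_mul, PowerSeries.coeff_derivative]; push_cast; ring
lemma th_mul (f g : PowerSeries ℝ) : th (f * g) = th f * g + f * th g := by
  simp only [th, Derivation.leibniz, smul_eq_mul]; ring
lemma th_add (f g : PowerSeries ℝ) : th (f + g) = th f + th g := by
  simp only [th, map_add]; ring
lemma th_C (A : ℝ) (f : PowerSeries ℝ) : th (PowerSeries.C A * f) = PowerSeries.C A * th f := by
  ext n; simp only [coeff_th, PowerSeries.coeff_C_mul]; ring

noncomputable def rr : PowerSeries ℝ := PowerSeries.X * PowerSeries.mk 1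

lemma coeff_rr_mul (f : PowerSeries ℝ) (n : ℕ) :
    PowerSeries.coeff (n+1) (rr * f) = ∑ k ∈ Finset.range (n+1), PowerSeries.coeff k f := by
  rw [rr, mul_assoc, PowerSeries.coeff_succ_X_mul, PowerSeries.coeff_mul,
    ← Finset.Nat.sum_antidiagonal_swap, Finset.Nat.sum_antidiagonal_eq_sum_range_succ_mk]
  simp

noncomputable def cc (A : ℝ) : ℕ → ℝ
  | 0 => 1
  | i + 1 => A / ((i:ℝ)+1)^2 * ∏ k ∈ Finset.range i, (1 + A / ((k:ℝ)+1)^2)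

lemma sum_cc (A : ℝ) (N : ℕ) :
    ∑ i ∈ Finset.range (N+1), cc A i = ∏ k ∈ Finset.range N, (1 + A / ((k:ℝ)+1)^2) := by
  induction N with
  | zero => simp [cc]
  | succ N ih => rw [Finset.sum_range_succ, ih, Finset.prod_range_succ, cc]; ring

lemma th_cc (A : ℝ) : th (th (PowerSeries.mk (cc A))) = PowerSeries.C A * (rr * PowerSeries.mk (cc A)) := by
  ext n
  rw [coeff_th, coeff_th, PowerSeries.coeff_C_mul]
  cases n with
  | zero => simp [rr]
  | succ n =>
    rw [coeff_rr_mul]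
    simp only [PowerSeries.coeff_mk]
    rw [sum_cc, cc]
    push_cast
    have : (n:ℝ) + 1 ≠ 0 := by positivity
    field_simp

lemma pq_eq (A B : ℝ) (N : ℕ) :
    (pq (A + B) (4 * A * B) N).1 = ∑ k ∈ Finset.range (N+1),
      ∑ kl ∈ Finset.HasAntidiagonal.antidiagonal k, cc A kl.1 * cc B kl.2 := by
  set U := PowerSeries.mk (cc A) with hU
  set V := PowerSeries.mk (cc B) with hV
  have hUU := th_cc A
  have hVV := th_cc B
  rw [← hU] at hUU
  rw [← hV] at hVV
  set G := U * V with hG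
  set W := PowerSeries.C 2 * (th U * th V) with hW
  set H := PowerSeries.C 2 * (PowerSeries.C A * (U * th V) + PowerSeries.C B * (V * th U)) with hH
  have e1 : th (th G) = PowerSeries.C (A + B) * (rr * G) + W := by
    rw [hG, th_mul, th_add, th_mul, th_mul, hUU, hVV, hW]
    simp only [map_add, map_ofNat]
    ring
  have e2 : th W = rr * H := by
    rw [hW, th_C, th_mul, hUU, hVV, hH]
    ring
  have e3 : th H = PowerSeries.C (A + B) * W + PowerSeries.C (4 * A * B) * (rr * G) := by
    rw [hH, th_C, th_add, th_C, th_C, th_mul, th_mul, hUU, hVV, hW, hG]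
    simp only [map_add, map_ofNat, map_mul]
    ring
  have key : ∀ N, (pq (A + B) (4 * A * B) N).1 = ∑ k ∈ Finset.range (N+1), PowerSeries.coeff k G ∧
      (pq (A + B) (4 * A * B) N).2 = ∑ k ∈ Finset.range (N+1), PowerSeries.coeff k H := by
    intro N
    induction N with
    | zero => simp [pq, hG, hH, hU, hV, th, cc]
    | succ N ih =>
      have f1 := congrArg (PowerSeries.coeff (N+1)) e1
      have f2 := congrArg (PowerSeries.coeff (N+1)) e2
      have f3 := congrArg (PowerSeries.coeff (N+1)) e3
      simp only [coeff_th, (PowerSeries.coeff (R := ℝ) (N+1)).map_add, PowerSeries.coeff_C_mul, coeff_rr_mul] at f1 f2 f3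
      rw [← ih.1] at f1
      rw [← ih.1] at f3
      rw [← ih.2] at f2
      rw [Finset.sum_range_succ _ (N+1), Finset.sum_range_succ _ (N+1), ← ih.1, ← ih.2, pq]
      push_cast at f1 f2 f3
      have hN : (N:ℝ) + 1 ≠ 0 := by positivity
      set p := (pq (A + B) (4 * A * B) N).1
      set q := (pq (A + B) (4 * A * B) N).2
      have g2 : PowerSeries.coeff (N+1) W = q / ((N:ℝ)+1) := by field_simp; linarith
      rw [g2] at f1 f3
      have g1 : PowerSeries.coeff (N+1) G = ((A+B) * p + q / ((N:ℝ)+1)) / ((N:ℝ)+1)^2 := by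
        rw [← f1]; field_simp
      have g3 : PowerSeries.coeff (N+1) H = ((A+B) * (q / ((N:ℝ)+1)) + 4 * A * B * p) / ((N:ℝ)+1) := by
        rw [← f3]; field_simp
      rw [g1, g3]
      constructor <;> (simp only; field_simp)
      · ring
      · ring
  rw [(key N).1]
  simp [hG, hU, hV, PowerSeries.coeff_mul]

lemma prod_tendsto (a : ℝ) (ha : 0 < a) :
    Filter.Tendsto (fun N => ∏ k ∈ Finset.range N, (1 + a^2 / ((k:ℝ)+1)^2)) Filter.atTop
      (nhds (Real.sinh (Real.pi * a) / (Real.pi * a))) := by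
  have h := Complex.tendsto_euler_sin_prod (a * Complex.I)
  have hpa : Real.pi * a ≠ 0 := by positivity
  have hpa' : (Real.pi * a * Complex.I : ℂ) ≠ 0 := by
    simp [Complex.I_ne_zero, ha.ne', Real.pi_ne_zero]
  have h2 := h.div_const (Real.pi * a * Complex.I : ℂ)
  rw [← mul_assoc, Complex.sin_mul_I] at h2
  have h3 : Filter.Tendsto (fun N => ((∏ k ∈ Finset.range N, (1 + a^2 / ((k:ℝ)+1)^2) : ℝ) : ℂ)) Filter.atTop
      (nhds ((Real.sinh (Real.pi * a) / (Real.pi * a) : ℝ) : ℂ)) := by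
    convert h2 using 1
    · ext N
      rw [mul_div_assoc, mul_comm, div_mul_cancel₀ _ hpa']
      push_cast
      apply Finset.prod_congr rfl
      intro k _
      rw [mul_pow, Complex.I_sq]; ring
    · push_cast
      rw [mul_div_mul_right _ _ Complex.I_ne_zero]
  have h4 := (Complex.continuous_re.tendsto _).comp h3
  simpa only [Function.comp_def, Complex.ofReal_re] using h4

lemma cc_nonneg (A : ℝ) (hA : 0 ≤ A) (i : ℕ) : 0 ≤ cc A i := by
  cases i with
  | zero => simp [cc]
  | succ i => rw [cc]; positivity

lemma cc_hasSum (a : ℝ) (ha : 0 < a) : HasSum (cc (a^2)) (Real.sinh (Real.pi * a) / (Real.pi * a)) := by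
  rw [hasSum_iff_tendsto_nat_of_nonneg (cc_nonneg _ (by positivity)), ← Filter.tendsto_add_atTop_iff_nat 1]
  simp only [sum_cc]
  exact prod_tendsto a ha

lemma pq_tendsto (a b : ℝ) (ha : 0 < a) (hb : 0 < b) :
    Filter.Tendsto (fun N => (pq (a^2 + b^2) (4 * a^2 * b^2) N).1) Filter.atTop
      (nhds (Real.sinh (Real.pi * a) / (Real.pi * a) * (Real.sinh (Real.pi * b) / (Real.pi * b)))) := by
  simp only [pq_eq]
  rw [Filter.tendsto_add_atTop_iff_nat (f := fun N => ∑ k ∈ Finset.range N,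
      ∑ kl ∈ Finset.HasAntidiagonal.antidiagonal k, cc (a^2) kl.1 * cc (b^2) kl.2) 1]
  have h1 := (cc_hasSum a ha)
  have h2 := (cc_hasSum b hb)
  rw [← h1.tsum_eq, ← h2.tsum_eq, tsum_mul_tsum_eq_tsum_sum_antidiagonal_of_summable_norm h1.summable.norm h2.summable.norm]
  exact (summable_norm_sum_mul_antidiagonal_of_summable_norm h1.summable.norm h2.summable.norm).of_norm.hasSum.tendsto_sum_nat

lemma hasSum_shift1 (f : ℕ × ℕ → ℝ) (s : ℝ) (h : HasSum f s) :
    HasSum (fun mn : ℕ × ℕ => if mn.1 = 0 then 0 else f (mn.1 - 1, mn.2)) s := by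
  have hi : Function.Injective (fun mn : ℕ × ℕ => (mn.1 + 1, mn.2)) := by
    rintro ⟨a, b⟩ ⟨c, d⟩ h; simpa using h
  rw [← hi.hasSum_iff]
  · simpa [Function.comp_def] using h
  · rintro ⟨a, b⟩ hab
    cases a with
    | zero => simp
    | succ a => exact absurd ⟨(a, b), rfl⟩ hab

lemma hasSum_shift2 (f : ℕ × ℕ → ℝ) (s : ℝ) (h : HasSum f s) :
    HasSum (fun mn : ℕ × ℕ => if mn.2 = 0 then 0 else f (mn.1, mn.2 - 1)) s := by
  have hi : Function.Injective (fun mn : ℕ × ℕ => (mn.1, mn.2 + 1)) := by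
    rintro ⟨a, b⟩ ⟨c, d⟩ h; simpa using h
  rw [← hi.hasSum_iff]
  · simpa [Function.comp_def] using h
  · rintro ⟨a, b⟩ hab
    cases b with
    | zero => simp
    | succ b => exact absurd ⟨(a, b), rfl⟩ hab

lemma hasSum_ZA (x y : ℝ) (N : ℕ) :
    HasSum (fun mn : ℕ × ℕ => ZA N mn.1 mn.2 * (x ^ mn.1 * y ^ mn.2)) (pq x y N).1 ∧
    HasSum (fun mn : ℕ × ℕ => ZB N mn.1 mn.2 * (x ^ mn.1 * y ^ (mn.2 + 1))) (pq x y N).2 := by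
  induction N with
  | zero =>
    constructor
    · have := hasSum_ite_eq ((0, 0) : ℕ × ℕ) (1 : ℝ)
      change HasSum _ (1 : ℝ)
      convert this using 1
      ext ⟨m, n⟩
      simp only [ZA_zero]
      split_ifs with h
      · simp at h; simp [h]
      · simp
    · simp only [ZB_zero, zero_mul]; exact hasSum_zero
  | succ N ih =>
    obtain ⟨h1, h2⟩ := ih
    constructor
    · have := (h1.add (((hasSum_shift1 _ _ h1).mul_left x).div_const (((N:ℝ)+1)^2))).add
        ((hasSum_shift2 _ _ h2).div_const (((N:ℝ)+1)^3))
      rw [pq]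
      convert this using 1
      ext ⟨m, n⟩
      simp only [ZA_succ]
      cases m <;> cases n <;> simp <;> ring
    · have := (h2.add (((hasSum_shift1 _ _ h2).mul_left x).div_const (((N:ℝ)+1)^2))).add
        ((h1.mul_left y).div_const ((N:ℝ)+1))
      rw [pq]
      convert this using 1
      ext ⟨m, n⟩
      simp only [ZB_succ]
      cases m <;> simp <;> ring

lemma sum_range_two_mul' (f : ℕ → ℝ) (K : ℕ) :
    ∑ j ∈ Finset.range (2 * K), f j = ∑ n ∈ Finset.range K, (f (2 * n) + f (2 * n + 1)) := by
  induction K with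
  | zero => simp
  | succ K ih => 
    rw [show 2 * (K + 1) = 2 * K + 1 + 1 by ring, Finset.sum_range_succ, Finset.sum_range_succ, ih,
      Finset.sum_range_succ]; ring

lemma pow_expand (x u : ℝ) (M : ℕ) : (x + u) ^ (M + 1) =
    ∑ j ∈ Finset.range (2 * (M + 1)), u ^ j * x ^ (M + 1 - j) * ((M+1).choose j) := by
  rw [add_comm, add_pow]
  apply Finset.sum_subset
  · intro j; simp only [Finset.mem_range]; omega
  · intro j _ hj
    simp only [Finset.mem_range] at hj
    rw [Nat.choose_eq_zero_of_lt (by omega)]; simp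

lemma odd_part (x u : ℝ) (M : ℕ) : (x + u) ^ (M + 1) - (x - u) ^ (M + 1) =
    2 * u * ∑ n ∈ Finset.range (M + 1), (u ^ 2) ^ n * x ^ (M - 2 * n) * ((M+1).choose (2 * n + 1)) := by
  rw [sub_eq_add_neg x u, pow_expand, pow_expand, ← Finset.sum_sub_distrib, sum_range_two_mul', Finset.mul_sum]
  apply Finset.sum_congr rfl
  intro n _
  rw [show M + 1 - (2 * n + 1) = M - 2 * n by omega, pow_succ (-u), pow_mul (-u), pow_succ u, pow_mul u, neg_sq]
  ring

noncomputable def zz (m n : ℕ) : ℝ := (Nat.choose (2 * n + m) m) * Real.pi ^ (4 * n + 2 * m)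
        / ((2 * n + 1) * Nat.factorial (4 * n + 2 * m + 1))

noncomputable def FF (x y : ℝ) (Mn : ℕ × ℕ) : ℝ :=
  Real.pi ^ (2 * Mn.1) / (2 * Mn.1 + 1).factorial * ((Mn.1.choose (2 * Mn.2)) / (2 * Mn.2 + 1))
    * (x ^ (Mn.1 - 2 * Mn.2) * y ^ Mn.2)

lemma FF_fiber (a b : ℝ) (ha : 0 < a) (hb : 0 < b) (M : ℕ) :
    HasSum (fun n => FF (a^2+b^2) (4*a^2*b^2) (M, n))
      (((Real.pi * (a + b)) ^ (2 * (M+1)) / (2 * (M+1)).factorial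
        - (Real.pi * (a - b)) ^ (2 * (M+1)) / (2 * (M+1)).factorial) / (2 * Real.pi ^ 2 * (a * b))) := by
  have h1 : (((Real.pi * (a + b)) ^ (2 * (M+1)) / (2 * (M+1)).factorial
        - (Real.pi * (a - b)) ^ (2 * (M+1)) / (2 * (M+1)).factorial) / (2 * Real.pi ^ 2 * (a * b)))
      = ∑ n ∈ Finset.range (M+1), FF (a^2+b^2) (4*a^2*b^2) (M, n) := by
    have e := odd_part (a^2+b^2) (2*a*b) M
    rw [show a^2+b^2+2*a*b = (a+b)^2 by ring, show a^2+b^2-2*a*b = (a-b)^2 by ring, ← pow_mul, ← pow_mul] at e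
    rw [mul_pow, mul_pow, ← sub_div, ← mul_sub, e, ← mul_assoc, Finset.mul_sum, Finset.sum_div, Finset.sum_div]
    apply Finset.sum_congr rfl
    intro n _
    have hc : ((M+1).choose (2*n+1) : ℝ) * (2 * n + 1) = (M + 1) * M.choose (2*n) := by
      have := Nat.add_one_mul_choose_eq M (2*n)
      exact_mod_cast this.symm
    have hc' : ((M+1).choose (2*n+1) : ℝ) = (M + 1) * M.choose (2*n) / (2 * n + 1) := by
      field_simp; linarith
    rw [hc', FF, show 2 * (M + 1) = 2 * M + 1 + 1 by ring, Nat.factorial_succ (2 * M + 1)]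
    have : ((2*M+1).factorial : ℝ) ≠ 0 := by positivity
    have := Real.pi_ne_zero
    rw [show (2*a*b)^2 = 4*a^2*b^2 by ring]
    push_cast
    generalize (4*a^2*b^2)^n = Y
    generalize (a^2+b^2)^(M-2*n) = X
    field_simp
    ring
  rw [h1]
  apply hasSum_sum_of_ne_finset_zero
  intro n hn
  simp only [Finset.mem_range] at hn
  rw [FF, Nat.choose_eq_zero_of_lt (by simp only; omega)]; simp

lemma FF_hasSum (a b : ℝ) (ha : 0 < a) (hb : 0 < b) :
    HasSum (FF (a^2+b^2) (4*a^2*b^2))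
      (Real.sinh (Real.pi * a) / (Real.pi * a) * (Real.sinh (Real.pi * b) / (Real.pi * b))) := by
  have h0 : 0 ≤ FF (a^2+b^2) (4*a^2*b^2) := by
    intro Mn; simp only [FF, Pi.zero_apply]; positivity
  have h1 := (Real.hasSum_cosh (Real.pi * (a+b))).sub (Real.hasSum_cosh (Real.pi * (a-b)))
  rw [← hasSum_nat_add_iff' 1] at h1
  have h2 := h1.div_const (2 * Real.pi ^ 2 * (a * b))
  have hf := FF_fiber a b ha hb
  have hs : Summable (FF (a^2+b^2) (4*a^2*b^2)) := by
    rw [summable_prod_of_nonneg h0]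
    refine ⟨fun M => (hf M).summable, ?_⟩
    simp only [fun M => (hf M).tsum_eq]
    exact h2.summable
  have h3 := hs.hasSum.prod_fiberwise hf
  have h4 := h3.unique h2
  have h5 := hs.hasSum
  rw [h4] at h5
  convert h5 using 1
  rw [mul_add, mul_sub, Real.cosh_add, Real.cosh_sub]
  have := Real.pi_ne_zero
  simp
  field_simp
  ring

lemma zz_hasSum (a b : ℝ) (ha : 0 < a) (hb : 0 < b) :
    HasSum (fun mn : ℕ × ℕ => zz mn.1 mn.2 * ((a^2+b^2) ^ mn.1 * (4*a^2*b^2) ^ mn.2))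
      (Real.sinh (Real.pi * a) / (Real.pi * a) * (Real.sinh (Real.pi * b) / (Real.pi * b))) := by
  have hi : Function.Injective (fun mn : ℕ × ℕ => (mn.1 + 2 * mn.2, mn.2)) := by
    rintro ⟨a, b⟩ ⟨c, d⟩ h
    simp only [Prod.mk.injEq] at h ⊢
    omega
  have h := FF_hasSum a b ha hb
  rw [← hi.hasSum_iff] at h
  · convert h using 1
    ext ⟨m, n⟩
    simp only [Function.comp_def, FF, zz]
    rw [Nat.add_sub_cancel, show 2 * (m + 2 * n) = 4 * n + 2 * m by ring, add_comm m (2*n),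
      show (2*n+m).choose (2*n) = (2*n+m).choose m from (Nat.choose_symm_add)]
    congr 1
    field_simp
  · rintro ⟨M, n⟩ hMn
    have : M < 2 * n := by
      by_contra hlt
      apply hMn
      exact ⟨(M - 2*n, n), by simp only [Prod.mk.injEq, and_true]; omega⟩
    rw [FF, Nat.choose_eq_zero_of_lt this]; simp

lemma uniq0 (c : ℕ → ℝ) (r : ℝ) (hr : 0 < r)
    (h : ∀ y, 0 < y → y < r → HasSum (fun n => c n * y ^ n) 0) : c 0 = 0 := by
  have hs := (h (r/2) (by positivity) (by linarith)).summable.norm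
  have ht := tendsto_tsum_of_dominated_convergence (𝓕 := nhdsWithin (0:ℝ) (Set.Ioi 0))
    (f := fun y n => c n * y ^ n) (g := fun n => c n * 0 ^ n) hs ?_ ?_
  · rw [tsum_eq_single 0 (by intro n hn; simp [hn])] at ht
    have h2 : Filter.Tendsto (fun y : ℝ => ∑' n, c n * y ^ n) (nhdsWithin (0:ℝ) (Set.Ioi 0)) (nhds 0) := by
      apply Filter.Tendsto.congr' _ tendsto_const_nhds
      filter_upwards [Ioo_mem_nhdsGT hr] with y hy
      exact (h y hy.1 hy.2).tsum_eq.symm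
    simpa using tendsto_nhds_unique ht h2
  · intro n
    have : Continuous (fun y : ℝ => c n * y ^ n) := by fun_prop
    exact (this.tendsto 0).mono_left nhdsWithin_le_nhds
  · filter_upwards [Ioo_mem_nhdsGT (show 0 < r/2 by positivity)] with y hy n
    rw [norm_mul, norm_mul, norm_pow, norm_pow]
    gcongr
    rw [Real.norm_of_nonneg hy.1.le, Real.norm_of_nonneg (by positivity)]
    exact hy.2.le

lemma uniq (r : ℝ) (hr : 0 < r) (n : ℕ) : ∀ (c : ℕ → ℝ) 
    (_ : ∀ y, 0 < y → y < r → HasSum (fun n => c n * y ^ n) 0), c n = 0 := by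
  induction n with
  | zero => intro c h; exact uniq0 c r hr h
  | succ n ih =>
    intro c h
    apply ih (fun n => c (n+1))
    intro y hy hyr
    have h1 := h y hy hyr
    rw [← hasSum_nat_add_iff' 1] at h1
    have h2 := h1.div_const y
    convert h2 using 1
    · rfl
    · ext k; field_simp; ring
    · simp [uniq0 c r hr h]

lemma param (x y : ℝ) (hx : 0 < x) (hy : 0 < y) (hxy : y < x^2) :
    ∃ a b : ℝ, 0 < a ∧ 0 < b ∧ a^2+b^2 = x ∧ 4*a^2*b^2 = y := by
  have hu : 0 < √y := Real.sqrt_pos.2 hy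
  have hux : √y < x := by rw [Real.sqrt_lt' hx]; exact hxy
  have h1 : √(x - √y) < √(x + √y) := Real.sqrt_lt_sqrt (by linarith) (by linarith)
  have h0 := Real.sqrt_nonneg (x - √y)
  have e1 := Real.sq_sqrt (show 0 ≤ x - √y by linarith)
  have e2 := Real.sq_sqrt (show 0 ≤ x + √y by linarith)
  have e3 := Real.sq_sqrt hy.le
  refine ⟨(√(x + √y) + √(x - √y))/2, (√(x + √y) - √(x - √y))/2, by linarith, by linarith, ?_, ?_⟩
  · linear_combination (e1 + e2)/2
  · have : 2 * ((√(x + √y) + √(x - √y))/2) * ((√(x + √y) - √(x - √y))/2) = √y := by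
      linear_combination (e2 - e1)/2
    calc _ = (2 * ((√(x + √y) + √(x - √y))/2) * ((√(x + √y) - √(x - √y))/2))^2 := by ring
      _ = y := by rw [this, e3]

lemma zz_unique (z : ℕ → ℕ → ℝ)
    (h : ∀ a b : ℝ, 0 < a → 0 < b → HasSum (fun mn : ℕ × ℕ => z mn.1 mn.2 * ((a^2+b^2) ^ mn.1 * (4*a^2*b^2) ^ mn.2))
      (Real.sinh (Real.pi * a) / (Real.pi * a) * (Real.sinh (Real.pi * b) / (Real.pi * b)))) (m n : ℕ) :
    z m n = zz m n := by
  have hd : ∀ x y : ℝ, 0 < x → 0 < y → y < x^2 →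
      HasSum (fun nm : ℕ × ℕ => (z nm.2 nm.1 - zz nm.2 nm.1) * (x ^ nm.2 * y ^ nm.1)) 0 := by
    intro x y hx hy hxy
    obtain ⟨a, b, ha, hb, rfl, rfl⟩ := param x y hx hy hxy
    have h1 := (h a b ha hb).sub (zz_hasSum a b ha hb)
    rw [sub_self] at h1
    rw [← (Equiv.prodComm ℕ ℕ).hasSum_iff] at h1
    convert h1 using 1
    · rfl
    · ext ⟨n, m⟩
      simp [sub_mul]
  have hfib : ∀ x : ℝ, 0 < x → ∀ n, Summable (fun m => (z m n - zz m n) * x ^ m) := by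
    intro x hx n
    have hs := (hd x (x^2/2) hx (by positivity) (by have : 0 < x^2 := by positivity
                                                    linarith)).summable.prod_factor n
    have hs2 := hs.div_const ((x^2/2)^n)
    convert hs2 using 1
    · rfl
    · ext k
      field_simp
  have hz : ∀ x : ℝ, 0 < x → ∀ n, ∑' m, (z m n - zz m n) * x ^ m = 0 := by
    intro x hx n
    refine uniq (x^2) (by positivity) n (fun n => ∑' m, (z m n - zz m n) * x ^ m) ?_
    intro y hy hyx
    refine (hd x y hx hy hyx).prod_fiberwise (fun n => ?_)
    have := (hfib x hx n).hasSum.mul_right (y ^ n)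
    simpa only [mul_assoc] using this
  have := uniq 1 one_pos m (fun m => z m n - zz m n) (fun x hx _ => by
    have := (hfib x hx n).hasSum
    rwa [hz x hx n] at this)
  linarith

lemma ZA_term_le (a b : ℝ) (ha : 0 < a) (hb : 0 < b) (N m n : ℕ) :
    ZA N m n * ((a^2+b^2) ^ m * (4*a^2*b^2) ^ n) ≤ (pq (a^2+b^2) (4*a^2*b^2) N).1 :=
  le_hasSum (hasSum_ZA (a^2+b^2) (4*a^2*b^2) N).1 (m, n) (fun mn _ => by
    have := ZA_nonneg N mn.1 mn.2
    positivity)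

lemma pq_le (a b : ℝ) (ha : 0 < a) (hb : 0 < b) (N : ℕ) : (pq (a^2+b^2) (4*a^2*b^2) N).1 ≤
    (Real.sinh (Real.pi * a) / (Real.pi * a) * (Real.sinh (Real.pi * b) / (Real.pi * b))) := by
  refine Monotone.ge_of_tendsto ?_ (pq_tendsto a b ha hb) N
  intro N N' h
  refine hasSum_le ?_ (hasSum_ZA (a^2+b^2) (4*a^2*b^2) N).1 (hasSum_ZA (a^2+b^2) (4*a^2*b^2) N').1
  intro mn
  have : ZA N mn.1 mn.2 ≤ ZA N' mn.1 mn.2 := Sh_mono _ _ h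
  exact mul_le_mul_of_nonneg_right this (by positivity)

lemma zeta_shuffle_all (m n : ℕ) :
    zetaShuffle (List.replicate m 2) (List.flatten (List.replicate n [3, 1])) = zz m n := by
  have hbd : ∀ m n, ∃ B, ∀ N, ZA N m n ≤ B := by
    intro m n
    refine ⟨(Real.sinh (Real.pi * 1) / (Real.pi * 1) * (Real.sinh (Real.pi * 1) / (Real.pi * 1)))
      / ((1^2+1^2) ^ m * (4*1^2*1^2) ^ n), fun N => ?_⟩
    rw [le_div_iff₀ (by positivity)]
    exact (ZA_term_le 1 1 one_pos one_pos N m n).trans (pq_le 1 1 one_pos one_pos N)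
  set z : ℕ → ℕ → ℝ := fun m n =>
    zetaShuffle (List.replicate m 2) (List.flatten (List.replicate n [3, 1])) with hz
  have ht : ∀ m n, Filter.Tendsto (fun N => ZA N m n) Filter.atTop (nhds (z m n)) := by
    intro m n
    obtain ⟨B, hB⟩ := hbd m n
    exact tendsto_ZA m n B hB
  have hle : ∀ N m n, ZA N m n ≤ z m n := by
    intro N m n
    have hm : Monotone (fun N => ZA N m n) := Sh_mono _ _
    exact hm.ge_of_tendsto (ht m n) N
  refine zz_unique z ?_ m n
  intro a b ha hb
  set P := Real.sinh (Real.pi * a) / (Real.pi * a) * (Real.sinh (Real.pi * b) / (Real.pi * b))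
  have hz0 : ∀ m n, 0 ≤ z m n := fun m n => (ZA_nonneg 0 m n).trans (hle 0 m n)
  have hs : Summable (fun mn : ℕ × ℕ => z mn.1 mn.2 * ((a^2+b^2) ^ mn.1 * (4*a^2*b^2) ^ mn.2)) := by
    apply summable_of_sum_le (c := P)
    · intro mn
      have := hz0 mn.1 mn.2
      simp only [Pi.zero_apply]
      positivity
    · intro u
      have : Filter.Tendsto (fun N => ∑ mn ∈ u, ZA N mn.1 mn.2 * ((a^2+b^2) ^ mn.1 * (4*a^2*b^2) ^ mn.2))
          Filter.atTop (nhds (∑ mn ∈ u, z mn.1 mn.2 * ((a^2+b^2) ^ mn.1 * (4*a^2*b^2) ^ mn.2))) :=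
        tendsto_finsetSum _ (fun mn _ => (ht mn.1 mn.2).mul_const _)
      refine le_of_tendsto' this fun N => ?_
      refine le_trans ?_ (pq_le a b ha hb N)
      refine sum_le_hasSum u ?_ (hasSum_ZA (a^2+b^2) (4*a^2*b^2) N).1
      intro mn _
      have := ZA_nonneg N mn.1 mn.2
      positivity
  have hlim := tendsto_tsum_of_dominated_convergence (𝓕 := Filter.atTop)
    (f := fun N (mn : ℕ × ℕ) => ZA N mn.1 mn.2 * ((a^2+b^2) ^ mn.1 * (4*a^2*b^2) ^ mn.2))
    (g := fun mn : ℕ × ℕ => z mn.1 mn.2 * ((a^2+b^2) ^ mn.1 * (4*a^2*b^2) ^ mn.2)) hs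
    (fun mn => (ht mn.1 mn.2).mul_const _)
    (Filter.Eventually.of_forall fun N mn => by
      have := ZA_nonneg N mn.1 mn.2
      rw [Real.norm_of_nonneg (by positivity)]
      exact mul_le_mul_of_nonneg_right (hle N _ _) (by positivity))
  simp only [fun N => (hasSum_ZA (a^2+b^2) (4*a^2*b^2) N).1.tsum_eq] at hlim
  have h9 := hs.hasSum
  rw [tendsto_nhds_unique hlim (pq_tendsto a b ha hb)] at h9
  exact h9

/-- For all positive integers `m`, `n`,
`ζ({2}^m ⧢ {3,1}^n) = C(2n+m, m) ⬝ π^(4n+2m) / ((2n+1)⬝(4n+2m+1)!)`. -/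
theorem zeta_shuffle_two_pow_threeone_pow (m n : ℕ) (hm : 0 < m) (hn : 0 < n) :
    zetaShuffle (List.replicate m 2) (List.flatten (List.replicate n [3, 1]))
      = (Nat.choose (2 * n + m) m) * Real.pi ^ (4 * n + 2 * m)
        / ((2 * n + 1) * Nat.factorial (4 * n + 2 * m + 1)) := by
  exact zeta_shuffle_all m n
end

section
/- For every positive integer n, ζ({2} ⧢ {3,1}^n) — the sum of ζ(w) over all shuffles w of the single-element list (2) with the list {3,1}^n, counted with multiplicity — equals π^(4n+2) / (4n+3)!. -/
open PowerSeries in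
/-- integration against dt/t -/
noncomputable def Ix : PowerSeries ℝ →ₗ[ℝ] PowerSeries ℝ where
  toFun f := PowerSeries.mk fun k => coeff k f / k
  map_add' f g := by ext k; simp [add_div]
  map_smul' c f := by ext k; simp [mul_div_assoc]

open PowerSeries in
/-- integration against dt/(1-t) -/
noncomputable def Iy : PowerSeries ℝ →ₗ[ℝ] PowerSeries ℝ where
  toFun f := PowerSeries.mk fun k => (∑ j ∈ Finset.range k, coeff j f) / k
  map_add' f g := by ext k; simp [add_div, Finset.sum_add_distrib]
  map_smul' c f := by ext k; simp [← mul_div_assoc, Finset.mul_sum]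

theorem coeff_Ix (f : PowerSeries ℝ) (k : ℕ) :
    PowerSeries.coeff k (Ix f) = PowerSeries.coeff k f / k := by simp [Ix]

theorem coeff_Iy (f : PowerSeries ℝ) (k : ℕ) :
    PowerSeries.coeff k (Iy f) = (∑ j ∈ Finset.range k, PowerSeries.coeff j f) / k := by simp [Iy]

theorem cc_Ix (f : PowerSeries ℝ) : PowerSeries.constantCoeff (Ix f) = 0 := by
  rw [← PowerSeries.coeff_zero_eq_constantCoeff_apply, coeff_Ix]; simp

theorem cc_Iy (f : PowerSeries ℝ) : PowerSeries.constantCoeff (Iy f) = 0 := by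
  rw [← PowerSeries.coeff_zero_eq_constantCoeff_apply, coeff_Iy]; simp

/-- derivative -/
noncomputable abbrev DD (f : PowerSeries ℝ) : PowerSeries ℝ := PowerSeries.derivative ℝ f

theorem DD_mul (f g : PowerSeries ℝ) : DD (f * g) = DD f * g + f * DD g := by
  simp only [DD, Derivation.leibniz, smul_eq_mul]; ring

theorem X_DD_Ix (f : PowerSeries ℝ) (hf : PowerSeries.constantCoeff f = 0) :
    PowerSeries.X * DD (Ix f) = f := by
  ext k
  rcases k with _ | k
  · simp [hf]
  · rw [PowerSeries.coeff_succ_X_mul, PowerSeries.coeff_derivative, coeff_Ix]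
    push_cast
    field_simp

theorem X_DD_Iy (f : PowerSeries ℝ) :
    (1 - PowerSeries.X) * DD (Iy f) = f := by
  ext k
  rw [sub_mul, one_mul, map_sub]
  rcases k with _ | k
  · rw [PowerSeries.coeff_zero_X_mul, PowerSeries.coeff_derivative, coeff_Iy]; simp
  · rw [PowerSeries.coeff_succ_X_mul, PowerSeries.coeff_derivative, PowerSeries.coeff_derivative,
      coeff_Iy, coeff_Iy]
    rw [Finset.sum_range_succ]
    push_cast
    field_simp
    ring

theorem oneX_ne : (1 - PowerSeries.X : PowerSeries ℝ) ≠ 0 := by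
  intro h
  have := congrArg PowerSeries.constantCoeff h
  simp at this

theorem II_uniq (f a b : PowerSeries ℝ) (hf : PowerSeries.constantCoeff f = 0)
    (ha : PowerSeries.constantCoeff a = 0)
    (h : PowerSeries.X * ((1 - PowerSeries.X) * DD f)
      = (1 - PowerSeries.X) * a + PowerSeries.X * b) : f = Ix a + Iy b := by
  apply PowerSeries.derivative.ext (R := ℝ)
  · apply mul_left_cancel₀ oneX_ne
    apply mul_left_cancel₀ (PowerSeries.X_ne_zero (R := ℝ))
    refine h.trans ?_
    have h1 := X_DD_Ix a ha
    have h2 := X_DD_Iy b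
    simp only [map_add]
    linear_combination -(1 - PowerSeries.X) * h1 - PowerSeries.X * h2
  · simp [hf, cc_Ix, cc_Iy]

/-- A -/
noncomputable def AA : ℕ → PowerSeries ℝ
  | 0 => 1
  | p + 1 => Ix (Iy (AA p))

/-- A shifted -/
noncomputable def AS : ℕ → PowerSeries ℝ
  | 0 => 0
  | p + 1 => AA p

/-- B -/
noncomputable def BB (p : ℕ) : PowerSeries ℝ := Iy (AS p)

theorem cc_BB (p : ℕ) : PowerSeries.constantCoeff (BB p) = 0 := cc_Iy _

theorem DB (p : ℕ) : (1 - PowerSeries.X) * DD (BB p) = AS p := X_DD_Iy _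

theorem DA (p : ℕ) : PowerSeries.X * DD (AA p) = BB p := by
  rcases p with _ | p
  · simp [AA, BB, AS]
  · exact X_DD_Ix _ (cc_Iy _)

theorem mulAA (p q : ℕ) (h : p + q ≠ 0) : AA p * AA q = Ix (BB p * AA q + AA p * BB q) := by
  have := II_uniq (AA p * AA q) (BB p * AA q + AA p * BB q) 0 ?_ ?_ ?_
  · simpa using this
  · rcases p with _ | p
    · rcases q with _ | q
      · simp at h
      · simp [AA, cc_Ix]
    · simp [AA, cc_Ix]
  · simp [cc_BB]
  · rw [DD_mul]
    linear_combination (1 - PowerSeries.X) * (AA q * DA p + AA p * DA q)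

theorem mulBA (p q : ℕ) : BB p * AA q = Ix (BB p * BB q) + Iy (AS p * AA q) := by
  refine II_uniq _ _ _ ?_ ?_ ?_
  · simp [cc_BB]
  · simp [cc_BB]
  · rw [DD_mul]
    linear_combination PowerSeries.X * AA q * DB p + (1 - PowerSeries.X) * BB p * DA q

theorem mulBB (p q : ℕ) : BB p * BB q = Iy (BB p * AS q + AS p * BB q) := by
  have := II_uniq (BB p * BB q) 0 (BB p * AS q + AS p * BB q) ?_ ?_ ?_
  · simpa using this
  · simp [cc_BB]
  · simp
  · rw [DD_mul]
    linear_combination PowerSeries.X * (BB q * DB p + BB p * DB q)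

/-- bilinear sums -/
noncomputable def SS (c : ℕ → ℕ → ℝ) (f g : ℕ → PowerSeries ℝ) (N : ℕ) : PowerSeries ℝ :=
  ∑ x ∈ Finset.HasAntidiagonal.antidiagonal N, c x.1 x.2 • (f x.1 * g x.2)

theorem SS_swap (c : ℕ → ℕ → ℝ) (f g : ℕ → PowerSeries ℝ) (N : ℕ) :
    SS c f g N = SS (fun p q => c q p) g f N := by
  unfold SS
  rw [← Finset.Nat.sum_antidiagonal_swap]
  simp [mul_comm]

theorem SS_congr (c d : ℕ → ℕ → ℝ) (f g : ℕ → PowerSeries ℝ) (N : ℕ) 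
    (h : ∀ p q, p + q = N → c p q = d p q) : SS c f g N = SS d f g N := by
  unfold SS
  apply Finset.sum_congr rfl
  intro x hx
  rw [h _ _ (Finset.HasAntidiagonal.mem_antidiagonal.1 hx)]

theorem SS_smul (c : ℕ → ℕ → ℝ) (r : ℝ) (f g : ℕ → PowerSeries ℝ) (N : ℕ) :
    SS (fun p q => r * c p q) f g N = r • SS c f g N := by
  unfold SS
  simp [Finset.smul_sum, mul_smul]

theorem SS_add (c d : ℕ → ℕ → ℝ) (f g : ℕ → PowerSeries ℝ) (N : ℕ) :
    SS (fun p q => c p q + d p q) f g N = SS c f g N + SS d f g N := by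
  unfold SS
  simp [Finset.sum_add_distrib, add_smul]

theorem SS_AA (c : ℕ → ℕ → ℝ) (N : ℕ) (hN : N ≠ 0) :
    SS c AA AA N = Ix (SS c BB AA N + SS c AA BB N) := by
  unfold SS
  rw [← Finset.sum_add_distrib, map_sum]
  apply Finset.sum_congr rfl
  intro x hx
  rw [mulAA _ _ (by rw [Finset.HasAntidiagonal.mem_antidiagonal.1 hx]; exact hN), ← smul_add, map_smul]

theorem SS_BA (c : ℕ → ℕ → ℝ) (N : ℕ) :
    SS c BB AA N = Ix (SS c BB BB N) + Iy (SS c AS AA N) := by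
  unfold SS
  rw [map_sum, map_sum, ← Finset.sum_add_distrib]
  apply Finset.sum_congr rfl
  intro x hx
  rw [mulBA, map_smul, map_smul, smul_add]

theorem SS_BB (c : ℕ → ℕ → ℝ) (N : ℕ) :
    SS c BB BB N = Iy (SS c BB AS N + SS c AS BB N) := by
  unfold SS
  rw [← Finset.sum_add_distrib, map_sum]
  apply Finset.sum_congr rfl
  intro x hx
  rw [mulBB, ← smul_add, map_smul]

theorem SS_AS_left (c : ℕ → ℕ → ℝ) (g : ℕ → PowerSeries ℝ) (N : ℕ) :
    SS c AS g (N + 1) = SS (fun p q => c (p + 1) q) AA g N := by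
  unfold SS
  rw [Finset.Nat.sum_antidiagonal_succ]
  simp [AS]

theorem SS_AS_right (c : ℕ → ℕ → ℝ) (f : ℕ → PowerSeries ℝ) (N : ℕ) :
    SS c f AS (N + 1) = SS (fun p q => c p (q + 1)) f AA N := by
  unfold SS
  rw [Finset.Nat.sum_antidiagonal_succ']
  simp [AS]

theorem BB_shift (c : ℕ → ℕ → ℝ) (f : ℕ → PowerSeries ℝ) (N : ℕ) :
    SS c f BB (N + 1) = SS (fun p q => c p (q + 1)) f (fun q => BB (q + 1)) N := by
  unfold SS
  rw [Finset.Nat.sum_antidiagonal_succ']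
  simp [BB, AS]

/-- signs -/
def sg (p _q : ℕ) : ℝ := (-1) ^ p
/-- weighted signs -/
def sw (p q : ℕ) : ℝ := (-1) ^ p * ((p : ℝ) - q)

theorem eq_zero_of_neg (f : PowerSeries ℝ) (h : f = (-1 : ℝ) • f) : f = 0 := by
  rw [neg_one_smul] at h
  ext k
  have := congrArg (PowerSeries.coeff k) h
  simp at this ⊢
  linarith

theorem sg_odd_zero (f : ℕ → PowerSeries ℝ) (N : ℕ) (hN : Odd N) : SS sg f f N = 0 := by
  apply eq_zero_of_neg
  conv_lhs => rw [SS_swap]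
  rw [← SS_smul]
  apply SS_congr
  rintro p q rfl
  unfold sg
  rcases Nat.even_or_odd p with hp | hp
  · have hq : Odd q := by grind
    simp [hp.neg_one_pow, hq.neg_one_pow]
  · have hq : Even q := by grind
    simp [hp.neg_one_pow, hq.neg_one_pow]

theorem sg_even_swap (f g : ℕ → PowerSeries ℝ) (N : ℕ) (hN : Even N) :
    SS sg f g N = SS sg g f N := by
  rw [SS_swap]
  apply SS_congr
  rintro p q rfl
  unfold sg
  rcases Nat.even_or_odd p with hp | hp
  · have hq : Even q := by grind
    simp [hp.neg_one_pow, hq.neg_one_pow]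
  · have hq : Odd q := by grind
    simp [hp.neg_one_pow, hq.neg_one_pow]

theorem sw_even_zero (f : ℕ → PowerSeries ℝ) (N : ℕ) (hN : Even N) : SS sw f f N = 0 := by
  apply eq_zero_of_neg
  conv_lhs => rw [SS_swap]
  rw [← SS_smul]
  apply SS_congr
  rintro p q rfl
  unfold sw
  rcases Nat.even_or_odd p with hp | hp
  · have hq : Even q := by grind
    simp [hp.neg_one_pow, hq.neg_one_pow]
  · have hq : Odd q := by grind
    simp [hp.neg_one_pow, hq.neg_one_pow]

theorem sw_odd_swap (f g : ℕ → PowerSeries ℝ) (N : ℕ) (hN : Odd N) :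
    SS sw f g N = SS sw g f N := by
  rw [SS_swap]
  apply SS_congr
  rintro p q rfl
  unfold sw
  rcases Nat.even_or_odd p with hp | hp
  · have hq : Odd q := by grind
    simp [hp.neg_one_pow, hq.neg_one_pow]
  · have hq : Even q := by grind
    simp [hp.neg_one_pow, hq.neg_one_pow]

theorem SS_AS_AS (c : ℕ → ℕ → ℝ) (N : ℕ) :
    SS c AS AS (N + 2) = SS (fun p q => c (p + 1) (q + 1)) AA AA N := by
  rw [SS_AS_left c AS (N + 1), SS_AS_right]

theorem BS (c : ℕ → ℕ → ℝ) (N : ℕ) :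
    SS c BB AS (N + 2) = Ix (SS (fun p q => c p (q + 1)) BB BB (N + 1))
      + Iy (SS (fun p q => c (p + 1) (q + 1)) AA AA N) := by
  rw [SS_AS_right c BB (N + 1), SS_BA, SS_AS_left]

theorem sg_succ (p q : ℕ) : sg (p + 1) q = (-1) * sg p q := by unfold sg; ring

theorem G_rec (n : ℕ) : SS sg BB BB (2 * n + 2) = (-2 : ℝ) • Iy (Iy (SS sg AA AA (2 * n))) := by
  rw [SS_BB, ← sg_even_swap BB AS _ (by grind), BS]
  have h1 : SS (fun p q => sg p (q + 1)) BB BB (2 * n + 1) = 0 :=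
    sg_odd_zero BB _ (by grind)
  have h2 : SS (fun p q => sg (p + 1) (q + 1)) AA AA (2 * n) = (-1 : ℝ) • SS sg AA AA (2 * n) := by
    rw [← SS_smul]
    apply SS_congr
    intro p q _
    exact sg_succ p q
  rw [h1, h2, ← two_smul ℝ]
  simp only [map_zero, zero_add, map_smul, smul_smul]
  norm_num

theorem E_rec (n : ℕ) : SS sg AA AA (2 * n + 2)
    = (-4 : ℝ) • Ix (Ix (Iy (Iy (SS sg AA AA (2 * n))))) := by
  rw [SS_AA _ _ (by simp), ← sg_even_swap BB AA _ (by grind), SS_BA, G_rec, SS_AS_left]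
  have h1 : SS (fun p q => sg (p + 1) q) AA AA (2 * n + 1) = 0 := by
    rw [show (fun p q => sg (p + 1) q) = fun p q => (-1) * sg p q from by
      funext p q; exact sg_succ p q, SS_smul, sg_odd_zero _ _ (by grind), smul_zero]
  rw [h1, ← two_smul ℝ]
  simp only [map_zero, add_zero, map_smul, smul_smul]
  norm_num

theorem P_rec (n : ℕ) : SS sw AA AA (2 * n + 3)
    = (-2 : ℝ) • Ix (Iy (SS sg AA AA (2 * n + 2)))
      + (-4 : ℝ) • Ix (Ix (Iy (Iy (SS sw AA AA (2 * n + 1)))))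
      + (-4 : ℝ) • Ix (Ix (Iy (Ix (SS sg BB BB (2 * n + 2))))) := by
  rw [SS_AA _ _ (by simp), ← sw_odd_swap BB AA _ (by grind), SS_BA, SS_BB,
    ← sw_odd_swap BB AS _ (by grind), show 2 * n + 3 = (2 * n + 1) + 2 from rfl, BS,
    SS_AS_left]
  have h1 : SS (fun p q => sw (p + 1) q) AA AA (2 * n + 1 + 1)
      = (-1 : ℝ) • SS sg AA AA (2 * n + 2) := by
    rw [show (fun p q => sw (p + 1) q) = fun p q => (-1) * sw p q + (-1) * sg p q from by
      funext p q; unfold sw sg; push_cast; ring, SS_add, SS_smul, SS_smul,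
      sw_even_zero _ _ (by grind), smul_zero, zero_add]
  have h2 : SS (fun p q => sw p (q + 1)) BB BB (2 * n + 1 + 1)
      = (-1 : ℝ) • SS sg BB BB (2 * n + 2) := by
    rw [show (fun p q => sw p (q + 1)) = fun p q => sw p q + (-1) * sg p q from by
      funext p q; unfold sw sg; push_cast; ring, SS_add, SS_smul,
      sw_even_zero _ _ (by grind), zero_add]
  have h3 : SS (fun p q => sw (p + 1) (q + 1)) AA AA (2 * n + 1)
      = (-1 : ℝ) • SS sw AA AA (2 * n + 1) := by
    rw [← SS_smul]
    apply SS_congr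
    intro p q _
    unfold sw; push_cast; ring
  rw [h1, h2, h3, ← two_smul ℝ, ← two_smul ℝ]
  simp only [map_add, map_smul, smul_smul, smul_add]
  norm_num
  abel

/-- multiple polylogarithm series -/
noncomputable def Ls : List ℕ → PowerSeries ℝ
  | [] => 1
  | s :: l => (Ix^[s - 1]) (Iy (Ls l))

/-- `{3,1}^n` -/
def l31 (n : ℕ) : List ℕ := List.flatten (List.replicate n [3, 1])

theorem l31_succ (n : ℕ) : l31 (n + 1) = 3 :: 1 :: l31 n := by
  simp [l31, List.replicate_succ]

theorem E_eq (n : ℕ) : SS sg AA AA (2 * n) = ((-4 : ℝ) ^ n) • Ls (l31 n) := by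
  induction n with
  | zero => simp [SS, sg, l31, Ls, AA]
  | succ n ih =>
    rw [show 2 * (n + 1) = 2 * n + 2 from by ring, E_rec, ih, l31_succ]
    simp only [map_smul, smul_smul, Ls]
    rw [pow_succ']
    rfl

/-- sum of all shuffles -/
noncomputable def WW (n : ℕ) : PowerSeries ℝ := ((listShuffles [2] (l31 n)).map Ls).sum

theorem map_Ls_sum (L : List (List ℕ)) (s : ℕ) :
    ((L.map (s :: ·)).map Ls).sum = (Ix^[s - 1]) (Iy ((L.map Ls).sum)) := by
  induction L with
  | nil => 
    simp only [List.map_nil, List.sum_nil, map_zero]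
    rw [← Module.End.coe_pow, map_zero]
  | cons a L ih =>
    simp only [List.map_cons, List.sum_cons, map_add] at ih ⊢
    rw [ih]
    simp only [← Module.End.coe_pow, map_add, Ls]

theorem shuf_succ (n : ℕ) : listShuffles [2] (l31 (n + 1)) =
    (2 :: 3 :: 1 :: l31 n) :: (3 :: 2 :: 1 :: l31 n) ::
      ((listShuffles [2] (l31 n)).map (1 :: ·)).map (3 :: ·) := by
  rw [l31_succ]
  simp [listShuffles]

theorem WW_succ (n : ℕ) : WW (n + 1) = Ix (Iy (Ls (l31 (n + 1))))
    + Ix (Ix (Iy (Ix (Iy (Iy (Ls (l31 n)))))))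
    + Ix (Ix (Iy (Iy (WW n)))) := by
  unfold WW
  rw [shuf_succ, List.map_cons, List.map_cons, List.sum_cons, List.sum_cons, map_Ls_sum,
    map_Ls_sum, l31_succ, ← add_assoc]
  rfl

theorem P_eq (n : ℕ) : SS sw AA AA (2 * n + 1) = (-2 * (-4 : ℝ) ^ n) • WW n := by
  induction n with
  | zero =>
    simp [SS, sw, WW, l31, AA, listShuffles, Ls, Finset.Nat.antidiagonal_succ]
    rw [← neg_add, ← two_smul ℝ]
  | succ n ih =>
    rw [show 2 * (n + 1) + 1 = 2 * n + 3 from by ring, P_rec, ih, G_rec,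
      show 2 * n + 2 = 2 * (n + 1) from by ring, E_eq, E_eq, WW_succ]
    simp only [map_smul, smul_smul, smul_add, pow_succ]
    module

/-- partial sums -/
noncomputable def psum (l : PowerSeries ℝ) (K : ℕ) : ℝ :=
  ∑ j ∈ Finset.range K, PowerSeries.coeff j l

theorem coeff_AA_succ (p j : ℕ) :
    PowerSeries.coeff j (AA (p + 1)) = psum (AA p) j / (j : ℝ) ^ 2 := by
  rw [AA, coeff_Ix, coeff_Iy, div_div, sq, psum]

theorem psum_zero (p : ℕ) : psum (AA p) 0 = 0 := by simp [psum]

theorem psum_AA_zero (K : ℕ) : psum (AA 0) (K + 1) = 1 := by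
  rw [psum, Finset.sum_range_succ']
  simp [AA, PowerSeries.coeff_one]

theorem coeff_AA_nonneg (p : ℕ) : ∀ j, 0 ≤ PowerSeries.coeff j (AA p) := by
  induction p with
  | zero => intro j; simp only [AA, PowerSeries.coeff_one]; split_ifs <;> norm_num
  | succ p ih =>
    intro j
    rw [coeff_AA_succ]
    exact div_nonneg (Finset.sum_nonneg fun i _ => ih i) (by positivity)

/-- ζ(2) -/
noncomputable def zc : ℝ := ∑' j : ℕ, 1 / (j : ℝ) ^ 2

theorem zc_summable : Summable fun j : ℕ => 1 / (j : ℝ) ^ 2 :=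
  Real.summable_one_div_nat_pow.2 (by norm_num)

theorem zc_nonneg : 0 ≤ zc := tsum_nonneg fun j => by positivity

theorem psum_nonneg (p K : ℕ) : 0 ≤ psum (AA p) K :=
  Finset.sum_nonneg fun i _ => coeff_AA_nonneg p i

theorem psum_le (p : ℕ) : ∀ K, psum (AA p) K ≤ zc ^ p := by
  induction p with
  | zero =>
    intro K
    rcases K with _ | K
    · simp [psum]
    · rw [psum_AA_zero]; simp
  | succ p ih =>
    intro K
    have : psum (AA (p + 1)) K ≤ ∑ j ∈ Finset.range K, zc ^ p * (1 / (j : ℝ) ^ 2) := by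
      apply Finset.sum_le_sum
      intro j _
      rw [coeff_AA_succ, div_eq_mul_one_div]
      exact mul_le_mul_of_nonneg_right (ih j) (by positivity)
    refine this.trans ?_
    rw [← Finset.mul_sum, pow_succ]
    apply mul_le_mul_of_nonneg_left _ (pow_nonneg zc_nonneg _)
    exact zc_summable.sum_le_tsum _ (fun i _ => by positivity)

theorem AA_summable (p : ℕ) : Summable fun j => PowerSeries.coeff j (AA p) :=
  summable_of_sum_range_le (coeff_AA_nonneg p) (psum_le p)

/-- value at 1 -/
noncomputable def aa (p : ℕ) : ℝ := ∑' j, PowerSeries.coeff j (AA p)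

theorem psum_tendsto (p : ℕ) :
    Filter.Tendsto (fun K => psum (AA p) K) Filter.atTop (nhds (aa p)) :=
  (AA_summable p).hasSum.tendsto_sum_nat

theorem aa_le (p : ℕ) : aa p ≤ zc ^ p :=
  le_of_tendsto (psum_tendsto p) (Filter.Eventually.of_forall (psum_le p))

theorem aa_nonneg (p : ℕ) : 0 ≤ aa p := tsum_nonneg (coeff_AA_nonneg p)

theorem fin_prod (x : ℂ) (K : ℕ) :
    HasSum (fun p => (psum (AA p) (K + 1) : ℂ) * x ^ p)
      (∏ j ∈ Finset.range K, (1 + x / ((j : ℂ) + 1) ^ 2)) := by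
  induction K with
  | zero =>
    rw [Finset.prod_range_zero]
    convert hasSum_ite_eq (0 : ℕ) (1 : ℂ) using 2 with p
    rcases p with _ | p
    · simp [psum_AA_zero]
    · simp [psum, coeff_AA_succ]
  | succ K ih =>
    rw [Finset.prod_range_succ, mul_add, mul_one]
    have h2 : HasSum (fun p => match p with
        | 0 => (0 : ℂ)
        | p + 1 => ((psum (AA p) (K + 1) : ℂ) * x ^ p) * (x / ((K : ℂ) + 1) ^ 2))
        ((∏ j ∈ Finset.range K, (1 + x / ((j : ℂ) + 1) ^ 2)) * (x / ((K : ℂ) + 1) ^ 2)) := by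
      rw [← hasSum_nat_add_iff' 1]
      simpa using ih.mul_right (x / ((K : ℂ) + 1) ^ 2)
    convert ih.add h2 using 2 with p
    rcases p with _ | p
    · simp [psum_AA_zero]
    · rw [psum, Finset.sum_range_succ, ← psum, coeff_AA_succ]
      push_cast
      ring

theorem norm_bd (p : ℕ) (t : ℝ) (ht : 0 ≤ t) (h : t ≤ zc ^ p) (x : ℂ) :
    ‖(t : ℂ) * x ^ p‖ ≤ (zc * ‖x‖) ^ p := by
  rw [norm_mul, norm_pow, Complex.norm_real, Real.norm_of_nonneg ht, mul_pow]
  exact mul_le_mul_of_nonneg_right h (by positivity)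

theorem geo_sum (x : ℂ) (hx : zc * ‖x‖ < 1) : Summable fun p : ℕ => (zc * ‖x‖) ^ p :=
  summable_geometric_of_lt_one (mul_nonneg zc_nonneg (norm_nonneg _)) hx

theorem prod_tendsto_s2 (x : ℂ) (hx : zc * ‖x‖ < 1) :
    Filter.Tendsto (fun K : ℕ => ∏ j ∈ Finset.range K, (1 + x / ((j : ℂ) + 1) ^ 2)) Filter.atTop
      (nhds (∑' p, (aa p : ℂ) * x ^ p)) := by
  have : (fun K : ℕ => ∏ j ∈ Finset.range K, (1 + x / ((j : ℂ) + 1) ^ 2))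
      = fun K : ℕ => ∑' p, (psum (AA p) (K + 1) : ℂ) * x ^ p := by
    funext K
    exact (fin_prod x K).tsum_eq.symm
  rw [this]
  apply tendsto_tsum_of_dominated_convergence (geo_sum x hx)
  · intro p
    apply Filter.Tendsto.mul_const
    exact (Complex.continuous_ofReal.tendsto _).comp
      ((psum_tendsto p).comp (Filter.tendsto_add_atTop_nat 1))
  · exact Filter.Eventually.of_forall fun K p => norm_bd p _ (psum_nonneg _ _) (psum_le _ _) x

/-- target coefficients -/
noncomputable def bb (p : ℕ) : ℝ := Real.pi ^ (2 * p) / (Nat.factorial (2 * p + 1) : ℝ)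

theorem bb_hasSum (x : ℂ) (hx : zc * ‖x‖ < 1) (hx0 : x ≠ 0) :
    HasSum (fun p => (bb p : ℂ) * x ^ p) (∑' p, (aa p : ℂ) * x ^ p) := by
  obtain ⟨z, hz⟩ := IsAlgClosed.exists_pow_nat_eq (-x) (n := 2) (by norm_num)
  have hz0 : z ≠ 0 := by
    rintro rfl
    apply hx0
    simpa using hz.symm
  have hx' : x = -z ^ 2 := by rw [hz]; ring
  have hpz : (Real.pi : ℂ) * z ≠ 0 := mul_ne_zero (by exact_mod_cast Real.pi_ne_zero) hz0
  have h1 := Complex.tendsto_euler_sin_prod z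
  have h2 := (prod_tendsto_s2 x hx).const_mul ((Real.pi : ℂ) * z)
  have h3 : Complex.sin (Real.pi * z) = (Real.pi : ℂ) * z * ∑' p, (aa p : ℂ) * x ^ p := by
    refine tendsto_nhds_unique h1 (h2.congr fun K => ?_)
    congr 1
    apply Finset.prod_congr rfl
    intro j _
    rw [hx']
    ring
  have h4 := (Complex.hasSum_sin (Real.pi * z)).mul_left ((Real.pi : ℂ) * z)⁻¹
  rw [h3, inv_mul_cancel_left₀ hpz] at h4
  refine Eq.mp (congrArg (fun f => HasSum f _) (funext fun p => ?_)) h4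
  unfold bb
  rw [hx', neg_pow (z ^ 2)]
  push_cast
  field_simp
  ring

theorem aa_zero : aa 0 = 1 := by
  unfold aa
  simp only [AA, PowerSeries.coeff_one]
  exact tsum_ite_eq 0 _

theorem aa_eq (p : ℕ) : aa p = bb p := by
  have hev : ∀ᶠ x : ℂ in nhds 0, zc * ‖x‖ < 1 := by
    have : Filter.Tendsto (fun x : ℂ => zc * ‖x‖) (nhds 0) (nhds (zc * ‖(0 : ℂ)‖)) := by
      apply Continuous.tendsto
      fun_prop
    exact this.eventually (gt_mem_nhds (by simp))
  have hA : HasFPowerSeriesAt (fun x : ℂ => ∑' p, (aa p : ℂ) * x ^ p)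
      (FormalMultilinearSeries.ofScalars ℂ (fun p => (aa p : ℂ))) 0 := by
    rw [hasFPowerSeriesAt_iff]
    filter_upwards [hev] with x hx
    simp only [FormalMultilinearSeries.coeff_ofScalars, zero_add, smul_eq_mul]
    have hs : Summable fun p => (aa p : ℂ) * x ^ p :=
      Summable.of_norm_bounded (geo_sum x hx) fun p => norm_bd p _ (aa_nonneg p) (aa_le p) x
    simpa only [mul_comm] using hs.hasSum
  have hB : HasFPowerSeriesAt (fun x : ℂ => ∑' p, (aa p : ℂ) * x ^ p)
      (FormalMultilinearSeries.ofScalars ℂ (fun p => (bb p : ℂ))) 0 := by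
    rw [hasFPowerSeriesAt_iff]
    filter_upwards [hev] with x hx
    simp only [FormalMultilinearSeries.coeff_ofScalars, zero_add, smul_eq_mul]
    by_cases hx0 : x = 0
    · subst hx0
      rw [tsum_eq_single 0 (by intro p hp; simp [hp])]
      have := hasSum_single (f := fun p : ℕ => (0 : ℂ) ^ p * (bb p : ℂ)) 0
        (by intro p hp; simp [hp])
      simpa [aa_zero, bb] using this
    · simpa only [mul_comm] using bb_hasSum x hx hx0
  have h := congrArg (fun q => FormalMultilinearSeries.coeff q p)
    (hA.eq_formalMultilinearSeries hB)
  simp only [FormalMultilinearSeries.coeff_ofScalars] at h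
  exact_mod_cast h

open Classical in
/-- truncated sums in ENNReal -/
noncomputable def Zf (l : List ℕ) (K : ℕ∞) : ENNReal :=
  ∑' k : Fin l.length → ℕ, if StrictAnti k ∧ ∀ i, 0 < k i ∧ (k i : ℕ∞) < K then
    ∏ i, ENNReal.ofReal (1 / ((k i : ℝ) ^ l.get i)) else 0

theorem strictAnti_cons {n : ℕ} (j : ℕ) (k : Fin n → ℕ) :
    StrictAnti (Fin.cons j k : Fin (n + 1) → ℕ) ↔ StrictAnti k ∧ ∀ i, k i < j := by
  constructor
  · intro h
    refine ⟨fun a b hab => ?_, fun i => ?_⟩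
    · have := h (Fin.succ_lt_succ_iff.2 hab)
      simpa using this
    · have := h (Fin.succ_pos i)
      simpa using this
  · rintro ⟨h1, h2⟩ a b hab
    induction a using Fin.cases with
    | zero =>
      induction b using Fin.cases with
      | zero => exact absurd hab (lt_irrefl _)
      | succ b => simpa using h2 b
    | succ a =>
      induction b using Fin.cases with
      | zero => exact absurd hab (by simp)
      | succ b => simpa using h1 (Fin.succ_lt_succ_iff.1 hab)

open Classical in
theorem Zf_cons (s : ℕ) (l : List ℕ) (K : ℕ∞) : Zf (s :: l) K =
    ∑' j : ℕ, if 0 < j ∧ (j : ℕ∞) < K then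
      ENNReal.ofReal (1 / (j : ℝ) ^ s) * Zf l j else 0 := by
  unfold Zf
  refine ((Fin.consEquiv (fun _ : Fin (l.length + 1) => ℕ)).tsum_eq _).symm.trans ?_
  rw [ENNReal.tsum_prod']
  apply tsum_congr
  intro j
  by_cases hj : 0 < j ∧ (j : ℕ∞) < K
  · rw [if_pos hj, ← ENNReal.tsum_mul_left]
    apply tsum_congr
    intro k
    have hiff : (StrictAnti (Fin.cons j k : Fin (l.length + 1) → ℕ) ∧
        ∀ i, 0 < (Fin.cons j k : Fin (l.length + 1) → ℕ) i ∧
          (((Fin.cons j k : Fin (l.length + 1) → ℕ) i : ℕ) : ℕ∞) < K) ↔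
        (StrictAnti k ∧ ∀ i, 0 < k i ∧ (k i : ℕ∞) < (j : ℕ∞)) := by
      rw [strictAnti_cons, Fin.forall_fin_succ]
      simp only [Fin.cons_zero, Fin.cons_succ, Nat.cast_lt]
      constructor
      · rintro ⟨⟨h1, h2⟩, _, h3⟩
        exact ⟨h1, fun i => ⟨(h3 i).1, h2 i⟩⟩
      · rintro ⟨h1, h2⟩
        exact ⟨⟨h1, fun i => (h2 i).2⟩, hj, fun i => ⟨(h2 i).1,
          lt_trans (by exact_mod_cast (h2 i).2) hj.2⟩⟩
    by_cases hk : StrictAnti k ∧ ∀ i, 0 < k i ∧ (k i : ℕ∞) < (j : ℕ∞)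
    · rw [if_pos hk]
      refine (if_pos (hiff.2 hk)).trans ?_
      exact Fin.prod_univ_succ _
    · rw [if_neg hk, mul_zero]
      exact if_neg (fun h => hk (hiff.1 h))
  · rw [if_neg hj]
    rw [ENNReal.tsum_eq_zero]
    intro k
    apply if_neg
    rintro ⟨_, h⟩
    exact hj (h 0)

theorem Ix_iter (m : ℕ) (f : PowerSeries ℝ) (j : ℕ) :
    PowerSeries.coeff j ((Ix^[m]) f) = PowerSeries.coeff j f / (j : ℝ) ^ m := by
  induction m with
  | zero => simp
  | succ m ih =>
    rw [Function.iterate_succ_apply', coeff_Ix, ih, pow_succ, div_div]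

theorem coeff_Ls_cons (s : ℕ) (hs : 1 ≤ s) (l : List ℕ) (j : ℕ) :
    PowerSeries.coeff j (Ls (s :: l))
      = 1 / (j : ℝ) ^ s * ∑ i ∈ Finset.range j, PowerSeries.coeff i (Ls l) := by
  obtain ⟨m, rfl⟩ : ∃ m, s = m + 1 := ⟨s - 1, by omega⟩
  rw [Ls, Ix_iter, coeff_Iy, div_div, Nat.add_sub_cancel, ← pow_succ', one_div, div_eq_inv_mul]

theorem coeff_Ls_nonneg (l : List ℕ) (hl : ∀ s ∈ l, 1 ≤ s) :
    ∀ j, 0 ≤ PowerSeries.coeff j (Ls l) := by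
  induction l with
  | nil => intro j; simp only [Ls, PowerSeries.coeff_one]; split_ifs <;> norm_num
  | cons s l ih =>
    intro j
    rw [coeff_Ls_cons s (hl s (by simp))]
    exact mul_nonneg (by positivity) (Finset.sum_nonneg fun i _ =>
      ih (fun s hs => hl s (by simp [hs])) i)

open Classical in
theorem Zf_eq (l : List ℕ) (hl : ∀ s ∈ l, 1 ≤ s) : ∀ K : ℕ∞, 0 < K → Zf l K =
    ∑' j : ℕ, if (j : ℕ∞) < K then ENNReal.ofReal (PowerSeries.coeff j (Ls l)) else 0 := by
  induction l with
  | nil =>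
    intro K hK
    rw [tsum_eq_single 0]
    · unfold Zf
      rw [tsum_eq_single (fun i => i.elim0)]
      · rw [if_pos, if_pos]
        · simp [Ls]
        · simpa using hK
        · exact ⟨fun i => i.elim0, fun i => i.elim0⟩
      · intro b hb
        exact absurd (funext fun i => i.elim0) hb
    · intro j hj
      simp [Ls, PowerSeries.coeff_one, hj]
  | cons s l ih =>
    have hl' : ∀ s ∈ l, 1 ≤ s := fun s hs => hl s (by simp [hs])
    intro K hK
    rw [Zf_cons]
    apply tsum_congr
    intro j
    rw [coeff_Ls_cons s (hl s (by simp))]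
    rcases Nat.eq_zero_or_pos j with rfl | hj
    · simp
    · by_cases hjK : (j : ℕ∞) < K
      · rw [if_pos ⟨hj, hjK⟩, if_pos hjK, ih hl' _ (by exact_mod_cast hj),
          ENNReal.ofReal_mul (by positivity),
          ENNReal.ofReal_sum_of_nonneg (fun i _ => coeff_Ls_nonneg l hl' i)]
        congr 1
        rw [tsum_eq_sum (s := Finset.range j)]
        · apply Finset.sum_congr rfl
          intro i hi
          rw [if_pos]
          exact_mod_cast Finset.mem_range.1 hi
        · intro i hi
          rw [if_neg]
          intro h
          exact hi (Finset.mem_range.2 (by exact_mod_cast h))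
      · rw [if_neg hjK, if_neg (fun h => hjK h.2)]

open Classical in
theorem mzv_eq (l : List ℕ) (hl : ∀ s ∈ l, 1 ≤ s) :
    mzv l = ∑' j, PowerSeries.coeff j (Ls l) := by
  have h1 : mzv l = (Zf l ⊤).toReal := by
    unfold Zf mzv
    rw [ENNReal.tsum_toReal_eq]
    · refine (tsum_subtype {k : Fin l.length → ℕ | StrictAnti k ∧ ∀ i, 0 < k i}
        (fun k => ∏ i, 1 / ((k i : ℝ) ^ l.get i))).trans ?_
      apply tsum_congr
      intro k
      by_cases hk : StrictAnti k ∧ ∀ i, 0 < k i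
      · rw [Set.indicator_of_mem (by exact hk), if_pos ⟨hk.1, fun i => ⟨hk.2 i, by simp⟩⟩,
          ENNReal.toReal_prod]
        apply Finset.prod_congr rfl
        intro i _
        rw [ENNReal.toReal_ofReal (by positivity)]
      · rw [Set.indicator_of_notMem (by exact hk), if_neg]
        · simp
        · exact fun h => hk ⟨h.1, fun i => (h.2 i).1⟩
    · intro k
      split_ifs
      · exact ENNReal.prod_ne_top fun i _ => ENNReal.ofReal_ne_top
      · simp
  rw [h1, Zf_eq l hl _ (by simp), ENNReal.tsum_toReal_eq]
  · apply tsum_congr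
    intro j
    rw [if_pos (by simp), ENNReal.toReal_ofReal (coeff_Ls_nonneg l hl j)]
  · intro j
    split_ifs
    · exact ENNReal.ofReal_ne_top
    · simp

theorem sum_even_odd (f : ℕ → ℂ) (N : ℕ) :
    ∑ m ∈ Finset.range (2 * N), f m = ∑ p ∈ Finset.range N, (f (2 * p) + f (2 * p + 1)) := by
  induction N with
  | zero => simp
  | succ N ih =>
    rw [show 2 * (N + 1) = 2 * N + 1 + 1 from by ring, Finset.sum_range_succ,
      Finset.sum_range_succ, ih, Finset.sum_range_succ]
    ring

theorem re_sum (N : ℕ) : ∑ p ∈ Finset.range (N + 1), (-1 : ℝ) ^ p * ((2 * N + 1).choose (2 * p) : ℝ)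
    = ((Complex.I + 1) ^ (2 * N + 1)).re := by
  rw [add_pow, show 2 * N + 1 + 1 = 2 * (N + 1) from by ring, sum_even_odd, Complex.re_sum]
  apply Finset.sum_congr rfl
  intro p _
  have h1 : Complex.I ^ (2 * p) = (((-1 : ℝ) ^ p : ℝ) : ℂ) := by
    rw [pow_mul, Complex.I_sq]; push_cast; rfl
  rw [pow_succ, h1]
  simp only [one_pow, mul_one]
  have h2 : ∀ (a b c : ℝ), ((a : ℂ) * (b : ℂ) + (a : ℂ) * Complex.I * (c : ℂ)).re = a * b := by
    intro a b c
    simp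
  exact (h2 _ _ _).symm

theorem I_pow_val (n : ℕ) : ((Complex.I + 1) ^ (2 * (2 * n + 1) + 1)).re = -2 * (-4) ^ n := by
  have h : (Complex.I + 1) ^ (2 * (2 * n + 1) + 1)
      = (((-2 * (-4) ^ n : ℝ)) : ℂ) + (((2 * (-4) ^ n : ℝ)) : ℂ) * Complex.I := by
    have h2 : (Complex.I + 1) ^ 2 = 2 * Complex.I := by
      linear_combination Complex.I_sq
    have h4 : (Complex.I + 1) ^ 4 = -4 := by
      rw [show (4 : ℕ) = 2 * 2 from rfl, pow_mul, h2]
      linear_combination 4 * Complex.I_sq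
    rw [show 2 * (2 * n + 1) + 1 = 4 * n + 2 + 1 from by ring, pow_succ, pow_add, pow_mul, h4, h2]
    push_cast
    linear_combination 2 * (-4) ^ n * Complex.I_sq
  rw [h, Complex.add_re, Complex.ofReal_re, Complex.re_ofReal_mul, Complex.I_re, mul_zero, add_zero]

open Finset.HasAntidiagonal in
theorem T_val (n : ℕ) : ∑ x ∈ antidiagonal (2 * n + 1),
    (-1 : ℝ) ^ x.1 * (1 / ((Nat.factorial (2 * x.1) : ℝ) * (Nat.factorial (2 * x.2 + 1) : ℝ)))
    = -2 * (-4) ^ n / (Nat.factorial (4 * n + 3) : ℝ) := by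
  rw [← I_pow_val, ← re_sum, Finset.sum_div, ← Finset.Nat.sum_antidiagonal_eq_sum_range_succ_mk
    (fun x => (-1 : ℝ) ^ x.1 * ((2 * (2 * n + 1) + 1).choose (2 * x.1) : ℝ)
      / (Nat.factorial (4 * n + 3) : ℝ))]
  apply Finset.sum_congr rfl
  intro x hx
  have hx := mem_antidiagonal.1 hx
  rw [show 2 * (2 * n + 1) + 1 = 2 * x.1 + (2 * x.2 + 1) from by omega, Nat.cast_add_choose,
    show 4 * n + 3 = 2 * x.1 + (2 * x.2 + 1) from by omega]
  field_simp

open Finset.HasAntidiagonal in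
theorem V_val (n : ℕ) : ∑ x ∈ antidiagonal (2 * n + 1), sw x.1 x.2 * (bb x.1 * bb x.2)
    = -2 * (-4) ^ n * (Real.pi ^ (4 * n + 2) / (Nat.factorial (4 * n + 3) : ℝ)) := by
  have hT := T_val n
  have hT' := T_val n
  rw [← Finset.Nat.sum_antidiagonal_swap] at hT'
  have key : ∀ x ∈ antidiagonal (2 * n + 1), sw x.1 x.2 * (bb x.1 * bb x.2)
      = Real.pi ^ (4 * n + 2) / 2 * (
        (-1 : ℝ) ^ x.1 * (1 / ((Nat.factorial (2 * x.1) : ℝ) * (Nat.factorial (2 * x.2 + 1) : ℝ)))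
        + (-1 : ℝ) ^ x.swap.1 * (1 / ((Nat.factorial (2 * x.swap.1) : ℝ)
          * (Nat.factorial (2 * x.swap.2 + 1) : ℝ)))) := by
    rintro ⟨p, q⟩ hx
    have hx := mem_antidiagonal.1 hx
    simp only [Prod.swap_prod_mk] at hx ⊢
    have hs : (-1 : ℝ) ^ q = - (-1) ^ p := by
      rcases Nat.even_or_odd p with hp | hp
      · have hq : Odd q := by grind
        simp [hp.neg_one_pow, hq.neg_one_pow]
      · have hq : Even q := by grind
        simp [hp.neg_one_pow, hq.neg_one_pow]
    rw [hs, show 4 * n + 2 = 2 * p + 2 * q from by omega]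
    unfold sw bb
    rw [Nat.factorial_succ, Nat.factorial_succ, pow_add]
    push_cast
    field_simp
    ring
  rw [Finset.sum_congr rfl key, ← Finset.mul_sum, Finset.sum_add_distrib, hT, hT']
  ring

theorem hasSum_mulAA (p q : ℕ) :
    HasSum (fun j => PowerSeries.coeff j (AA p * AA q)) (bb p * bb q) := by
  have hn : ∀ p, Summable fun j => ‖PowerSeries.coeff j (AA p)‖ := fun p => (AA_summable p).norm
  simp only [PowerSeries.coeff_mul]
  rw [← aa_eq, ← aa_eq, aa, aa,
    tsum_mul_tsum_eq_tsum_sum_antidiagonal_of_summable_norm (hn p) (hn q)]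
  exact (summable_norm_sum_mul_antidiagonal_of_summable_norm (hn p) (hn q)).of_norm.hasSum

theorem hasSum_WW (n : ℕ) : HasSum (fun j => PowerSeries.coeff j (WW n))
    (Real.pi ^ (4 * n + 2) / (Nat.factorial (4 * n + 3) : ℝ)) := by
  have hne : (-2 * (-4 : ℝ) ^ n) ≠ 0 := by simp
  rw [hasSum_mul_left_iff hne |>.symm, ← V_val]
  have h : (fun j => -2 * (-4 : ℝ) ^ n * PowerSeries.coeff j (WW n))
      = fun j => ∑ x ∈ Finset.HasAntidiagonal.antidiagonal (2 * n + 1),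
        sw x.1 x.2 * PowerSeries.coeff j (AA x.1 * AA x.2) := by
    funext j
    have := congrArg (PowerSeries.coeff j) (P_eq n)
    rw [map_smul, smul_eq_mul] at this
    rw [← this, SS, map_sum]
    simp only [map_smul, smul_eq_mul]
  rw [h]
  exact hasSum_sum fun x _ => (hasSum_mulAA x.1 x.2).mul_left _

theorem list_sum (L : List (List ℕ)) (hL : ∀ w ∈ L, ∀ s ∈ w, 1 ≤ s) (v : ℝ)
    (h : HasSum (fun j => PowerSeries.coeff j ((L.map Ls).sum)) v) : (L.map mzv).sum = v := by
  induction L generalizing v with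
  | nil =>
    simp only [List.map_nil, List.sum_nil, map_zero] at h ⊢
    exact hasSum_zero.unique h
  | cons w L ih =>
    simp only [List.map_cons, List.sum_cons, map_add] at h ⊢
    have hw := coeff_Ls_nonneg w (hL w (by simp))
    have hL' : ∀ w ∈ L, ∀ s ∈ w, 1 ≤ s := fun w' hw' => hL w' (by simp [hw'])
    have hn : ∀ j, 0 ≤ PowerSeries.coeff j ((L.map Ls).sum) := by
      intro j
      rw [map_list_sum]
      apply List.sum_nonneg
      simp only [List.map_map, List.mem_map]
      rintro _ ⟨a, ha, rfl⟩
      exact coeff_Ls_nonneg a (hL' a ha) j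
    have s1 : Summable fun j => PowerSeries.coeff j (Ls w) :=
      Summable.of_nonneg_of_le hw (fun j => le_add_of_nonneg_right (hn j)) h.summable
    have s2 : Summable fun j => PowerSeries.coeff j ((L.map Ls).sum) :=
      Summable.of_nonneg_of_le hn (fun j => le_add_of_nonneg_left (hw j)) h.summable
    rw [ih hL' _ s2.hasSum, mzv_eq w (hL w (by simp))]
    exact (s1.hasSum.add s2.hasSum).unique h

theorem l31_pos (n : ℕ) : ∀ s ∈ l31 n, 1 ≤ s := by
  induction n with
  | zero => simp [l31]
  | succ n ih => rw [l31_succ]; simpa using ih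

theorem shuf_pos (n : ℕ) : ∀ w ∈ listShuffles [2] (l31 n), ∀ s ∈ w, 1 ≤ s := by
  induction n with
  | zero => simp [l31, listShuffles]
  | succ n ih =>
    have := l31_pos n
    rw [shuf_succ]
    simpa using ⟨this, ih⟩

/-- For every positive integer `n`, `ζ({2} ⧢ {3,1}^n) = π^(4n+2) / (4n+3)!`. -/
theorem zeta_shuffle_two_threeone_pow (n : ℕ) (hn : 0 < n) :
    zetaShuffle [2] (List.flatten (List.replicate n [3, 1]))
      = Real.pi ^ (4 * n + 2) / Nat.factorial (4 * n + 3) := by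
  exact list_sum _ (shuf_pos n) _ (hasSum_WW n)
end

section
/- For any positive integers n ≥ m, in the free ℤ-module on words over {A,B} one has Σ_{k=−n}^{n} (−1)^k k^(2m) · [(AB)^(n−k) ⧢ (AB)^(n+k)] = Σ_{j=1}^{m} 4^(n−j) · a_{2m,j} · T_{2n,n−j}, where a_{2m,j} = Σ_{k=−j}^{j} (−1)^k k^(2m) binom(2j, j−k). -/
/-- Words over the two-letter alphabet `{A, B}`, encoded as lists of booleans
with `A = true` and `B = false`. -/
abbrev Word := List Bool

/-- The shuffle product `u ⧢ v` of two words, as an element of the free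
ℤ-module on words (each interleaving counted with multiplicity). -/
noncomputable def wordShuffle (u v : Word) : Word →₀ ℤ :=
  ((listShuffles u v).map fun w => Finsupp.single w (1 : ℤ)).sum

/-- The word `(AB)^p = ABAB⋯AB` with `p` copies of `AB`. -/
def ABpow (p : ℕ) : Word := List.flatten (List.replicate p [true, false])

/-- The number of occurrences of the subword `AA` in a word, i.e. the number of
indices `i` such that positions `i` and `i+1` both hold the letter `A`. -/
def countAA (w : Word) : ℕ := (w.zip w.tail).count (true, true)

/-- `T_{N,j}` for `0 ≤ j ≤ ⌊N/2⌋`: the formal sum, each with coefficient 1, of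
the distinct words containing `AA` exactly `j` times that occur with nonzero
multiplicity in `(AB)^p ⧢ (AB)^q` for any `p + q = N` with `min(p,q) ≥ j`;
this set of words depends only on `N = p + q` and `j`, so we take `p = j`,
`q = N − j`. -/
noncomputable def T (N j : ℕ) : Word →₀ ℤ :=
  ∑ w ∈ (wordShuffle (ABpow j) (ABpow (N - j))).support.filter (fun w => countAA w = j),
    Finsupp.single w (1 : ℤ)


theorem cnt_nil (u v : Word) : (listShuffles u v).count [] = if u = [] ∧ v = [] then 1 else 0 := by
  rcases u with _ | ⟨a, u⟩ <;> rcases v with _ | ⟨b, v⟩ <;> simp [listShuffles, List.count_eq_zero]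

theorem lsh_nil (u : Word) : listShuffles u [] = [u] := by
  cases u <;> simp [listShuffles]

theorem nil_lsh (u : Word) : listShuffles [] u = [u] := by
  cases u <;> simp [listShuffles]

theorem cnt_map (a x : Bool) (w : Word) (L : List Word) :
    (L.map (a :: ·)).count (x :: w) = if a = x then L.count w else 0 := by
  split_ifs with h
  · subst h
    exact List.count_map_of_injective L _ (List.cons_injective) w
  · rw [List.count_eq_zero]
    simp [h]

theorem cnt_cons (a b x : Bool) (u v w : Word) :
    (listShuffles (a :: u) (b :: v)).count (x :: w)
      = (if a = x then (listShuffles u (b :: v)).count w else 0)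
        + (if b = x then (listShuffles (a :: u) v).count w else 0) := by
  rw [listShuffles, List.count_append, cnt_map, cnt_map]

theorem cnt_consl (a x : Bool) (u w : Word) :
    (listShuffles (a :: u) []).count (x :: w)
      = (if a = x then (listShuffles u []).count w else 0) := by
  rw [lsh_nil, lsh_nil, ← cnt_map]; rfl

theorem cnt_consr (a x : Bool) (u w : Word) :
    (listShuffles [] (a :: u)).count (x :: w)
      = (if a = x then (listShuffles [] u).count w else 0) := by
  rw [nil_lsh, nil_lsh, ← cnt_map]; rfl

theorem cnt_nn (x : Bool) (w : Word) :
    (listShuffles [] []).count (x :: w) = 0 := by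
  simp [listShuffles]

theorem ABpow_zero : ABpow 0 = [] := rfl
theorem ABpow_succ (p : ℕ) : ABpow (p + 1) = true :: false :: ABpow p := by
  simp [ABpow, List.replicate_succ]

def fz (w : Word) (p q : ℕ) : ℕ := (listShuffles (ABpow p) (ABpow q)).count w
def ft (w : Word) (p q : ℕ) : ℕ := (listShuffles (false :: ABpow p) (false :: ABpow q)).count w

def gg (j r p q : ℕ) : ℕ := if j ≤ p ∧ j ≤ q ∧ p + q = 2 * j + r then 4 ^ j * r.choose (p - j) else 0

theorem gg_base (p q : ℕ) : gg 0 0 p q = if p = 0 ∧ q = 0 then 1 else 0 := by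
  unfold gg
  split_ifs with h1 h2 h2
  · simp [h2.1]
  · omega
  · omega
  · rfl

theorem gg_zl (j r q : ℕ) : gg (j + 1) r 0 q = 0 := by simp [gg]
theorem gg_zr (j r q : ℕ) : gg (j + 1) r q 0 = 0 := by simp [gg]
theorem gg_ss (j r p q : ℕ) : gg (j + 1) r (p + 1) (q + 1) = 4 * gg j r p q := by
  unfold gg
  split_ifs with h1 h2 h2
  · rw [Nat.add_sub_add_right]; ring
  · omega
  · omega
  · rfl

theorem gg_pascal (j r p q : ℕ) : gg j (r + 1) (p + 1) (q + 1) = gg j r p (q + 1) + gg j r (p + 1) q := by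
  unfold gg
  by_cases h : p + q + 1 = 2 * j + r
  · by_cases hp : j ≤ p
    · by_cases hq : j ≤ q
      · rw [if_pos (by omega), if_pos (by omega), if_pos (by omega), Nat.sub_add_comm hp, Nat.choose_succ_succ]
        ring
      · by_cases hq' : j ≤ q + 1
        · rw [if_pos (by omega), if_pos (by omega), if_neg (by omega), Nat.sub_add_comm hp, Nat.choose_succ_succ,
            Nat.choose_eq_zero_of_lt (n := r) (k := p - j + 1) (by omega)]
          ring
        · rw [if_neg (by omega), if_neg (by omega), if_neg (by omega)]
    · by_cases hp' : j ≤ p + 1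
      · have : p + 1 - j = 0 := by omega
        by_cases hq : j ≤ q
        · rw [if_pos (by omega), if_neg (by omega), if_pos (by omega), this]
          simp
        · rw [if_neg (by omega), if_neg (by omega), if_neg (by omega)]
      · rw [if_neg (by omega), if_neg (by omega), if_neg (by omega)]
  · rw [if_neg (by omega), if_neg (by omega), if_neg (by omega)]

theorem gg_pl (j r q : ℕ) : gg j (r + 1) 0 (q + 1) = gg j r 0 q := by
  unfold gg
  split_ifs with h1 h2 h2
  · simp
  · omega
  · omega
  · rfl
theorem gg_pr (j r q : ℕ) : gg j (r + 1) (q + 1) 0 = gg j r q 0 := by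
  unfold gg
  split_ifs with h1 h2 h2
  · have h : j = 0 := by omega
    have : q = r := by omega
    subst h; subst this
    simp
  · omega
  · omega
  · rfl
theorem gg_pz (j r : ℕ) : gg j (r + 1) 0 0 = 0 := by
  unfold gg
  rw [if_neg (by omega)]

def Pz (w : Word) : Prop := (∀ p q, fz w p q = 0) ∨ ∃ r, ∀ p q, fz w p q = gg (countAA w) r p q
def Pt (w : Word) : Prop := (∀ p q, ft w p q = 0) ∨ ∃ r, ∀ p q, ft w p q = 2 * gg (countAA w) r p q

theorem fz_nil (p q : ℕ) : fz [] p q = gg 0 0 p q := by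
  rw [gg_base, fz, cnt_nil]
  cases p <;> cases q <;> simp [ABpow_zero, ABpow_succ]

theorem fz_B (w : Word) (p q : ℕ) : fz (false :: w) p q = 0 := by
  cases p <;> cases q <;> simp [fz, ABpow_zero, ABpow_succ, cnt_cons, cnt_consl, cnt_consr, cnt_nn]

theorem fz_A (p q : ℕ) : fz [true] p q = 0 := by
  cases p <;> cases q <;> simp [fz, ABpow_zero, ABpow_succ, cnt_cons, cnt_consl, cnt_consr, cnt_nn, cnt_nil]

theorem ft_nil (p q : ℕ) : ft [] p q = 0 := by
  rw [ft, cnt_nil]; simp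
theorem ft_B (p q : ℕ) : ft [false] p q = 0 := by
  simp [ft, cnt_cons, cnt_nil]
theorem ft_A (w : Word) (p q : ℕ) : ft (true :: w) p q = 0 := by
  simp [ft, cnt_cons]
theorem ft_BB (w : Word) (p q : ℕ) : ft (false :: false :: w) p q = 2 * fz w p q := by
  cases p <;> cases q <;> simp [ft, fz, ABpow_zero, ABpow_succ, cnt_cons, cnt_consl, cnt_consr, cnt_nn] <;> ring
theorem ft_BA (w : Word) (p q : ℕ) : ft (false :: true :: w) p q =
    (if p = 0 then 0 else ft w (p - 1) q) + (if q = 0 then 0 else ft w p (q - 1)) := by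
  cases p <;> cases q <;> simp [ft, fz, ABpow_zero, ABpow_succ, cnt_cons, cnt_consl, cnt_consr, cnt_nn]
theorem fz_AB (w : Word) (p q : ℕ) : fz (true :: false :: w) p q =
    (if p = 0 then 0 else fz w (p - 1) q) + (if q = 0 then 0 else fz w p (q - 1)) := by
  cases p <;> cases q <;> simp [ft, fz, ABpow_zero, ABpow_succ, cnt_cons, cnt_consl, cnt_consr, cnt_nn]
theorem fz_AA (w : Word) (p q : ℕ) : fz (true :: true :: w) p q =
    if p = 0 ∨ q = 0 then 0 else 2 * ft w (p - 1) (q - 1) := by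
  cases p <;> cases q <;> simp [ft, fz, ABpow_zero, ABpow_succ, cnt_cons, cnt_consl, cnt_consr, cnt_nn] <;> ring

theorem cA_nil : countAA [] = 0 := rfl
theorem cA_B (w : Word) : countAA (false :: w) = countAA w := by
  cases w <;> simp [countAA]
theorem cA_AB (w : Word) : countAA (true :: false :: w) = countAA w := by
  rw [← cA_B w]
  simp [countAA]
theorem cA_AA (w : Word) : countAA (true :: true :: w) = countAA (true :: w) + 1 := by
  simp [countAA]
theorem cA_A (w : Word) (p q : ℕ) (h : ft w p q ≠ 0) : countAA (true :: w) = countAA w := by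
  rcases w with _ | ⟨_ | _, w⟩
  · rfl
  · rw [cA_AB, cA_B]
  · exact absurd (ft_A w p q) h

theorem gg_rec (j r p q : ℕ) : gg j (r + 1) p q =
    (if p = 0 then 0 else gg j r (p - 1) q) + (if q = 0 then 0 else gg j r p (q - 1)) := by
  rcases p with _ | p <;> rcases q with _ | q <;> simp [gg_pz, gg_pl, gg_pr, gg_pascal]

theorem main (n : ℕ) : ∀ w : Word, w.length ≤ n → Pz w ∧ Pt w := by
  induction n using Nat.strong_induction_on with
  | _ n ih =>
  intro w hw
  rcases w with _ | ⟨a, _ | ⟨b, w⟩⟩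
  · exact ⟨Or.inr ⟨0, fz_nil⟩, Or.inl ft_nil⟩
  · cases a
    · exact ⟨Or.inl (fz_B _), Or.inl ft_B⟩
    · exact ⟨Or.inl fz_A, Or.inl (ft_A _)⟩
  · simp only [List.length_cons] at hw
    obtain ⟨hz, ht⟩ := ih (n - 2) (by omega) w (by omega)
    cases a
    · refine ⟨Or.inl (fz_B _), ?_⟩
      cases b
      · rcases hz with h | ⟨r, h⟩
        · left; intro p q; rw [ft_BB, h]
        · right; refine ⟨r, fun p q => ?_⟩
          rw [ft_BB, h, cA_B, cA_B]
      · by_cases h0 : ∀ p q, ft w p q = 0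
        · left; intro p q; rw [ft_BA]; simp [h0]
        rcases ht with h | ⟨r, h⟩
        · exact absurd h h0
        · push Not at h0
          obtain ⟨p0, q0, h0⟩ := h0
          right; refine ⟨r + 1, fun p q => ?_⟩
          rw [ft_BA, h, h, cA_B, cA_A w p0 q0 h0, gg_rec]
          split_ifs <;> ring
    · refine ⟨?_, Or.inl (ft_A _)⟩
      cases b
      · rcases hz with h | ⟨r, h⟩
        · left; intro p q; rw [fz_AB]; simp [h]
        · right; refine ⟨r + 1, fun p q => ?_⟩
          rw [fz_AB, h, h, cA_AB, gg_rec]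
      · by_cases h0 : ∀ p q, ft w p q = 0
        · left; intro p q; rw [fz_AA]; simp [h0]
        rcases ht with h | ⟨r, h⟩
        · exact absurd h h0
        · push Not at h0
          obtain ⟨p0, q0, h0⟩ := h0
          right; refine ⟨r, fun p q => ?_⟩
          rw [fz_AA, h, cA_AA, cA_A w p0 q0 h0]
          rcases p with _ | p <;> rcases q with _ | q <;> simp [gg_zl, gg_zr, gg_ss]
          ring

theorem ws_apply (p q : ℕ) (w : Word) : wordShuffle (ABpow p) (ABpow q) w = (fz w p q : ℤ) := by
  unfold wordShuffle fz
  induction listShuffles (ABpow p) (ABpow q) with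
  | nil => simp
  | cons a L ih =>
    simp only [List.map_cons, List.sum_cons, Finsupp.add_apply, ih, List.count_cons, Finsupp.single_apply]
    by_cases h : a = w <;> simp [h, add_comm]

theorem T_apply (N j : ℕ) (w : Word) : T N j w = if fz w j (N - j) ≠ 0 ∧ countAA w = j then 1 else 0 := by
  unfold T
  rw [Finsupp.finsetSum_apply]
  simp only [Finsupp.single_apply, Finset.sum_ite_eq', Finset.mem_filter, Finsupp.mem_support_iff, ws_apply]
  simp

theorem a_zero (m j : ℕ) (hm : 0 < m) (h : j = 0 ∨ m < j) :
    ∑ k ∈ Finset.Icc (-(j : ℤ)) (j : ℤ), (k.negOnePow : ℤ) * k ^ (2 * m) *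
              (Nat.choose (2 * j) ((j : ℤ) - k).toNat : ℤ) = 0 := by
  rcases h with rfl | h
  · simp; omega
  have h1 := congrFun (fwdDiff_iter_pow_eq_zero_of_lt (R := ℤ) (j := 2 * m) (n := 2 * j) (by omega)) (-(j : ℤ))
  rw [fwdDiff_iter_eq_sum_shift] at h1
  have h2 : ((j : ℤ).negOnePow : ℤ) * ∑ k ∈ Finset.Icc (-(j : ℤ)) (j : ℤ), (k.negOnePow : ℤ) * k ^ (2 * m) *
              (Nat.choose (2 * j) ((j : ℤ) - k).toNat : ℤ) = 0 := by
    rw [Finset.mul_sum]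
    refine Eq.trans ?_ h1
    refine Finset.sum_nbij' (fun k => ((j : ℤ) - k).toNat) (fun i => (j : ℤ) - i) ?_ ?_ ?_ ?_ ?_
    · intro k hk
      simp only [Finset.mem_Icc, Finset.mem_range] at hk ⊢
      omega
    · intro k hk
      simp only [Finset.mem_Icc, Finset.mem_range] at hk ⊢
      omega
    · intro k hk
      simp only [Finset.mem_Icc] at hk ⊢
      omega
    · intro k hk
      simp only [Finset.mem_range] at hk ⊢
      omega
    · intro k hk
      simp only [Finset.mem_Icc] at hk
      obtain ⟨i, hi⟩ : ∃ i : ℕ, (j : ℤ) - k = i := ⟨((j : ℤ) - k).toNat, by omega⟩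
      obtain ⟨l, hl⟩ : ∃ l : ℕ, (j : ℤ) + k = l := ⟨((j : ℤ) + k).toNat, by omega⟩
      have e1 : 2 * j - i = l := by omega
      have e2 : -(j : ℤ) + i = -k := by omega
      have e3 : ((j : ℤ).negOnePow : ℤ) * (k.negOnePow : ℤ) = (-1) ^ l := by
        rw [← Units.val_mul, ← Int.negOnePow_add, hl]
        simp [Int.negOnePow_def]
      simp only [hi, Int.toNat_natCast, e1, nsmul_eq_mul, mul_one, smul_eq_mul]
      rw [e2, (even_two_mul m).neg_pow, ← e3]
      ring
  rcases mul_eq_zero.1 h2 with h3 | h3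
  · exact absurd h3 (Units.ne_zero _)
  · exact h3

theorem gg_int (n J r : ℕ) (k : ℤ) (hk : k ∈ Finset.Icc (-(n : ℤ)) n) (hr : 2 * J + r = 2 * n) :
    (gg J r ((n : ℤ) - k).toNat ((n : ℤ) + k).toNat : ℤ) =
      if k ∈ Finset.Icc (-((n - J : ℕ) : ℤ)) ((n - J : ℕ) : ℤ) then
        4 ^ J * (Nat.choose (2 * (n - J)) (((n - J : ℕ) : ℤ) - k).toNat : ℤ) else 0 := by
  simp only [Finset.mem_Icc] at hk ⊢
  unfold gg
  by_cases h : -((n - J : ℕ) : ℤ) ≤ k ∧ k ≤ ((n - J : ℕ) : ℤ)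
  · rw [if_pos h, if_pos (by omega)]
    have e1 : r = 2 * (n - J) := by omega
    have e2 : ((n : ℤ) - k).toNat - J = (((n - J : ℕ) : ℤ) - k).toNat := by omega
    rw [e1, e2]; push_cast; rfl
  · rw [if_neg h, if_neg (by omega)]; rfl

/-- For positive integers `n ≥ m`:
`∑_{k=−n}^{n} (−1)^k k^(2m) ⬝ [(AB)^(n−k) ⧢ (AB)^(n+k)]
  = ∑_{j=1}^{m} 4^(n−j) ⬝ a_{2m,j} ⬝ T_{2n,n−j}`,
where `a_{2m,j} = ∑_{k=−j}^{j} (−1)^k k^(2m) C(2j, j−k)`. -/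
theorem alternating_sum_ABpow_shuffle_even (m n : ℕ) (hm : 0 < m) (hmn : m ≤ n) :
    ∑ k ∈ Finset.Icc (-(n : ℤ)) (n : ℤ),
      (((k.negOnePow : ℤ) * k ^ (2 * m)) •
        wordShuffle (ABpow ((n : ℤ) - k).toNat) (ABpow ((n : ℤ) + k).toNat))
    = ∑ j ∈ Finset.Icc 1 m,
        ((4 ^ (n - j) *
          ∑ k ∈ Finset.Icc (-(j : ℤ)) (j : ℤ),
            (k.negOnePow : ℤ) * k ^ (2 * m) *
              (Nat.choose (2 * j) ((j : ℤ) - k).toNat : ℤ)) •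
          T (2 * n) (n - j)) := by
  ext w
  rw [Finsupp.finsetSum_apply, Finsupp.finsetSum_apply]
  simp only [Finsupp.smul_apply, smul_eq_mul, ws_apply, T_apply]
  rcases (main w.length w le_rfl).1 with h0 | ⟨r, h⟩
  · simp [h0]
  simp only [h]
  generalize countAA w = J
  by_cases hr : 2 * J + r = 2 * n
  · have hL : ∑ k ∈ Finset.Icc (-(n : ℤ)) (n : ℤ), (k.negOnePow : ℤ) * k ^ (2 * m) *
        (gg J r ((n : ℤ) - k).toNat ((n : ℤ) + k).toNat : ℤ) =
        4 ^ J * ∑ k ∈ Finset.Icc (-((n - J : ℕ) : ℤ)) ((n - J : ℕ) : ℤ),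
            (k.negOnePow : ℤ) * k ^ (2 * m) *
              (Nat.choose (2 * (n - J)) (((n - J : ℕ) : ℤ) - k).toNat : ℤ) := by
      rw [Finset.mul_sum]
      symm
      have hsub : Finset.Icc (-((n - J : ℕ) : ℤ)) ((n - J : ℕ) : ℤ) ⊆ Finset.Icc (-(n : ℤ)) (n : ℤ) := by
        apply Finset.Icc_subset_Icc <;> omega
      refine Finset.sum_subset_zero_on_sdiff hsub ?_ ?_
      · intro k hk
        rw [Finset.mem_sdiff] at hk
        rw [gg_int n J r k hk.1 hr, if_neg hk.2, mul_zero]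
      · intro k hk
        rw [gg_int n J r k (hsub hk) hr, if_pos hk]
        ring
    rw [hL]
    by_cases hj : 1 ≤ n - J ∧ n - J ≤ m
    · rw [Finset.sum_eq_single_of_mem (n - J) (Finset.mem_Icc.2 hj)]
      · have e : n - (n - J) = J := by omega
        rw [e, if_pos, mul_one]
        refine ⟨?_, rfl⟩
        unfold gg
        rw [if_pos (by omega)]
        simp
      · intro b hb hb'
        rw [Finset.mem_Icc] at hb
        rw [if_neg (by omega), mul_zero]
    · rw [a_zero m (n - J) hm (by omega), mul_zero]
      symm
      apply Finset.sum_eq_zero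
      intro b hb
      rw [Finset.mem_Icc] at hb
      rw [if_neg (by omega), mul_zero]
  · rw [Finset.sum_eq_zero, Finset.sum_eq_zero]
    · intro b hb
      rw [Finset.mem_Icc] at hb
      rw [if_neg, mul_zero]
      rintro ⟨h1, h2⟩
      apply h1
      unfold gg
      rw [if_neg (by omega)]
    · intro k hk
      rw [Finset.mem_Icc] at hk
      unfold gg
      rw [if_neg (by omega)]
      simp
end

section
/- For any positive integers n ≥ m, Σ_{k=1−n}^{n} (−1)^k k^(2m−1) · π^(4n−2) / ((2n+2k−1)! · (2n−2k+1)!) = Σ_{j=1}^{m} 4^(n−j) · a_{2m−1,j} · ζ({2}^(2j−1) ⧢ {3,1}^(n−j)), where a_{2m−1,j} = Σ_{k=1−j}^{j} (−1)^k k^(2m−1) binom(2j−1, j−k). -/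
namespace BB
open PowerSeries

noncomputable def A : PowerSeries ℝ →ₗ[ℝ] PowerSeries ℝ where
  toFun f := PowerSeries.mk fun n => coeff n f / n
  map_add' f g := by ext n; simp [add_div]
  map_smul' c f := by ext n; simp [mul_div_assoc]

noncomputable def B : PowerSeries ℝ →ₗ[ℝ] PowerSeries ℝ where
  toFun f := PowerSeries.mk fun n => (∑ k ∈ Finset.range n, coeff k f) / n
  map_add' f g := by ext n; simp [add_div, Finset.sum_add_distrib]
  map_smul' c f := by ext n; simp [← mul_div_assoc, Finset.mul_sum]

lemma coeff_A (f : PowerSeries ℝ) (n : ℕ) : coeff n (A f) = coeff n f / n := by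
  simp [A]

lemma coeff_B (f : PowerSeries ℝ) (n : ℕ) :
    coeff n (B f) = (∑ k ∈ Finset.range n, coeff k f) / n := by
  simp [B]

lemma cA (f : PowerSeries ℝ) : constantCoeff (A f) = 0 := by
  rw [← coeff_zero_eq_constantCoeff_apply, coeff_A]; simp

lemma cB (f : PowerSeries ℝ) : constantCoeff (B f) = 0 := by
  rw [← coeff_zero_eq_constantCoeff_apply, coeff_B]; simp

lemma dA (f : PowerSeries ℝ) (hf : constantCoeff f = 0) : X * d⁄dX ℝ (A f) = f := by
  ext n
  cases n with
  | zero => simp [hf]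
  | succ n =>
    rw [coeff_succ_X_mul, coeff_derivative, coeff_A]
    push_cast
    field_simp

lemma dB (f : PowerSeries ℝ) : (1 - X) * d⁄dX ℝ (B f) = f := by
  ext n
  cases n with
  | zero => rw [sub_mul, one_mul, map_sub, coeff_derivative, coeff_B]; simp
  | succ n =>
    rw [sub_mul, one_mul, map_sub, coeff_succ_X_mul, coeff_derivative, coeff_derivative, coeff_B,
      coeff_B, Finset.sum_range_succ _ (n+1)]
    push_cast
    field_simp
    ring

lemma X_ne : (X : PowerSeries ℝ) ≠ 0 := X_ne_zero

lemma oX_ne : (1 - X : PowerSeries ℝ) ≠ 0 := by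
  intro h
  have := congrArg (constantCoeff) h
  simp at this

lemma AA (f g : PowerSeries ℝ) (hf : constantCoeff f = 0) (hg : constantCoeff g = 0) :
    A f * A g = A (f * A g + A f * g) := by
  apply derivative.ext
  · apply mul_left_cancel₀ X_ne
    rw [dA _ (by simp [hf, hg]), Derivation.leibniz, smul_eq_mul, smul_eq_mul]
    linear_combination (A f) * dA g hg + A g * dA f hf
  · simp [cA]

lemma BBB (f g : PowerSeries ℝ) :
    B f * B g = B (f * B g + B f * g) := by
  apply derivative.ext
  · apply mul_left_cancel₀ oX_ne
    rw [dB, Derivation.leibniz, smul_eq_mul, smul_eq_mul]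
    linear_combination (B f) * dB g + B g * dB f
  · simp [cB]

lemma AB (f g : PowerSeries ℝ) (hf : constantCoeff f = 0) :
    A f * B g = A (f * B g) + B (A f * g) := by
  apply derivative.ext
  · apply mul_left_cancel₀ X_ne
    apply mul_left_cancel₀ oX_ne
    rw [map_add, Derivation.leibniz, smul_eq_mul, smul_eq_mul]
    linear_combination X * (A f) * dB g + (1-X) * B g * dA f hf
      - (1-X) * dA (f * B g) (by simp [hf]) - X * dB (A f * g)
  · simp [cA, cB]

/-- `Li_{2^p}` -/
noncomputable def F : ℕ → PowerSeries ℝ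
  | 0 => 1
  | p + 1 => A (B (F p))

noncomputable def P (p q : ℕ) : PowerSeries ℝ := F p * F q
noncomputable def H (p q : ℕ) : PowerSeries ℝ := F p * B (F q) + B (F p) * F q

lemma BFBF (p q : ℕ) : B (F p) * B (F q) = B (H p q) := by
  rw [BBB]; rfl

lemma FBF (p q : ℕ) : F (p+1) * B (F q) = B (P (p+1) q) + A (B (H p q)) := by
  have : F (p+1) = A (B (F p)) := rfl
  rw [this, AB _ _ (cB _), BFBF, P, this, add_comm]

lemma P_comm (p q : ℕ) : P p q = P q p := mul_comm _ _
lemma H_comm (p q : ℕ) : H p q = H q p := by unfold H; ring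

lemma BFF (p q : ℕ) : B (F p) * F (q+1) = B (P p (q+1)) + A (B (H p q)) := by
  rw [mul_comm, FBF, P_comm, H_comm]

lemma P_succ (p q : ℕ) : P (p+1) (q+1) =
    A (B (P p (q+1))) + A (B (P (p+1) q)) + (4:ℝ) • A (A (B ((2⁻¹:ℝ) • H p q))) := by
  have h1 : P (p+1) (q+1) = A (B (F p)) * A (B (F q)) := rfl
  rw [h1, AA _ _ (cB _) (cB _)]
  have h2 : A (B (F q)) = F (q+1) := rfl
  have h3 : A (B (F p)) = F (p+1) := rfl
  rw [h2, h3, BFF, FBF]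
  simp only [map_add, map_smul]
  module

lemma P_zero (p : ℕ) : P p 0 = F p := by simp [P, F]

lemma H_zero_zero : H 0 0 = (2:ℝ) • B (P 0 0) := by
  simp [H, P, F]; module

lemma H_succ_zero (p : ℕ) : H (p+1) 0 = (2:ℝ) • B (P (p+1) 0) + A (B (H p 0)) := by
  rw [H, FBF, P_zero]
  have : F 0 = 1 := rfl
  rw [this, mul_one]; module

lemma H_succ_succ (p q : ℕ) : H (p+1) (q+1) = (2:ℝ) • B (P (p+1) (q+1))
    + (A (B (H p (q+1))) + A (B (H (p+1) q))) := by
  rw [H, FBF, BFF]; module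

/-- generating series of a composition -/
noncomputable def L : List ℕ → PowerSeries ℝ
  | [] => 1
  | a :: s => PowerSeries.mk fun n => if n = 0 then 0 else
      (1 / (n:ℝ)^a) * ∑ k ∈ Finset.range n, coeff k (L s)

lemma L_one (s : List ℕ) : L (1 :: s) = B (L s) := by
  ext n; rw [coeff_B]; simp only [L, coeff_mk]
  split_ifs with h
  · simp [h]
  · field_simp

lemma L_two (s : List ℕ) : L (2 :: s) = A (B (L s)) := by
  ext n; rw [coeff_A, coeff_B]; simp only [L, coeff_mk]
  split_ifs with h
  · simp [h]
  · field_simp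

lemma L_three (s : List ℕ) : L (3 :: s) = A (A (B (L s))) := by
  ext n; rw [coeff_A, coeff_A, coeff_B]; simp only [L, coeff_mk]
  split_ifs with h
  · simp [h]
  · field_simp

def ls31 (j : ℕ) : List ℕ := List.flatten (List.replicate j [3, 1])

lemma ls31_succ (j : ℕ) : ls31 (j+1) = 3 :: 1 :: ls31 j := by
  simp [ls31, List.replicate_succ]

noncomputable def U (r j : ℕ) : PowerSeries ℝ :=
  ((listShuffles (List.replicate r 2) (ls31 j)).map L).sum

noncomputable def V (r j : ℕ) : PowerSeries ℝ :=
  ((listShuffles (List.replicate r 2) (1 :: ls31 j)).map L).sum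

lemma sum_two (l : List (List ℕ)) : ((l.map (2 :: ·)).map L).sum = A (B ((l.map L).sum)) := by
  induction l with
  | nil => simp
  | cons a l ih => simp only [List.map_cons, List.sum_cons, ih, L_two, map_add]
lemma sum_one (l : List (List ℕ)) : ((l.map (1 :: ·)).map L).sum = B ((l.map L).sum) := by
  induction l with
  | nil => simp
  | cons a l ih => simp only [List.map_cons, List.sum_cons, ih, L_one, map_add]
lemma sum_three (l : List (List ℕ)) : ((l.map (3 :: ·)).map L).sum = A (A (B ((l.map L).sum))) := by
  induction l with
  | nil => simp
  | cons a l ih => simp only [List.map_cons, List.sum_cons, ih, L_three, map_add]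

lemma shuf_nil (u : List ℕ) : listShuffles u [] = [u] := by
  cases u <;> simp [listShuffles]

lemma U_zero (r : ℕ) : U r 0 = F r := by
  have : ls31 0 = [] := rfl
  rw [U, this, shuf_nil]
  induction r with
  | zero => simp [L, F]
  | succ r ih =>
    simp only [List.map_cons, List.map_nil, List.sum_singleton, List.replicate_succ, L_two, F] at *
    rw [ih]

lemma U_zero_succ (j : ℕ) : U 0 (j+1) = A (A (B (V 0 j))) := by
  rw [U, V, ls31_succ]; simp [listShuffles, L_three]

lemma U_succ_succ (r j : ℕ) : U (r+1) (j+1) = A (B (U r (j+1))) + A (A (B (V (r+1) j))) := by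
  simp only [U, V, ls31_succ]
  rw [List.replicate_succ, listShuffles, List.map_append, List.sum_append, sum_two, sum_three]

lemma V_zero (j : ℕ) : V 0 j = B (U 0 j) := by
  rw [U, V]; simp [listShuffles, L_one]

lemma V_succ (r j : ℕ) : V (r+1) j = A (B (V r j)) + B (U (r+1) j) := by
  simp only [U, V]
  rw [List.replicate_succ, listShuffles, List.map_append, List.sum_append, sum_two, sum_one]

noncomputable def c (p q i : ℕ) : ℝ :=
  if i ≤ p ∧ i ≤ q then ((p + q - 2 * i).choose (q - i) : ℝ) else 0

/-- abstract Pascal step -/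
lemma pascal (D : PowerSeries ℝ →ₗ[ℝ] PowerSeries ℝ) (Y Z : ℕ → PowerSeries ℝ)
    (h0 : Y 0 = Z 0) (hs : ∀ r, Y (r+1) = D (Y r) + Z (r+1)) (p q i : ℕ) :
    c (p+1) (q+1) i • Y (p+1+(q+1) - 2*i) =
      D (c p (q+1) i • Y (p+(q+1)-2*i)) + D (c (p+1) q i • Y (p+1+q-2*i))
      + c (p+1) (q+1) i • Z (p+1+(q+1) - 2*i) := by
  rcases lt_or_ge (p+1) i with h | h
  · have e1 : c (p+1) (q+1) i = 0 := by simp [c]; omega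
    have e2 : c p (q+1) i = 0 := by simp [c]; omega
    have e3 : c (p+1) q i = 0 := by simp [c]; omega
    simp [e1, e2, e3]
  rcases lt_or_ge (q+1) i with h' | h'
  · have e1 : c (p+1) (q+1) i = 0 := by simp [c]; omega
    have e2 : c p (q+1) i = 0 := by simp [c]; omega
    have e3 : c (p+1) q i = 0 := by simp [c]; omega
    simp [e1, e2, e3]
  rcases Nat.eq_or_lt_of_le h with h1 | h1 <;> rcases Nat.eq_or_lt_of_le h' with h2 | h2
  · have e2 : c p (q+1) i = 0 := by simp [c]; omega
    have e3 : c (p+1) q i = 0 := by simp [c]; omega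
    have e : p+1+(q+1) - 2*i = 0 := by omega
    simp [e2, e3, e, h0]
  · have e2 : c p (q+1) i = 0 := by simp [c]; omega
    obtain ⟨v, rfl⟩ : ∃ v, q = i + v := ⟨q - i, by omega⟩
    have e1 : c (p+1) (i+v+1) i = 1 := by
      rw [c, if_pos (by omega), show p+1+(i+v+1)-2*i = v+1 by omega, show i+v+1-i = v+1 by omega]; simp
    have e3 : c (p+1) (i+v) i = 1 := by
      rw [c, if_pos (by omega), show p+1+(i+v)-2*i = v by omega, show i+v-i = v by omega]; simp
    rw [e1, e2, e3, show p+1+(i+v+1)-2*i = v+1 by omega, show p+1+(i+v)-2*i = v by omega, hs]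
    simp
  · have e3 : c (p+1) q i = 0 := by simp [c]; omega
    obtain ⟨v, rfl⟩ : ∃ v, p = i + v := ⟨p - i, by omega⟩
    have e1 : c (i+v+1) (q+1) i = 1 := by
      rw [c, if_pos (by omega), show i+v+1+(q+1)-2*i = v+1 by omega, show q+1-i = 0 by omega]; simp
    have e2 : c (i+v) (q+1) i = 1 := by
      rw [c, if_pos (by omega), show i+v+(q+1)-2*i = v by omega, show q+1-i = 0 by omega]; simp
    rw [e1, e2, e3, show i+v+1+(q+1)-2*i = v+1 by omega, show i+v+(q+1)-2*i = v by omega, hs]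
    simp
  · obtain ⟨u, rfl⟩ : ∃ v, p = i + v := ⟨p - i, by omega⟩
    obtain ⟨v, rfl⟩ : ∃ v, q = i + v := ⟨q - i, by omega⟩
    have e1 : c (i+u+1) (i+v+1) i = c (i+u) (i+v+1) i + c (i+u+1) (i+v) i := by
      rw [c, if_pos (by omega), c, if_pos (by omega), c, if_pos (by omega),
        show i+u+1+(i+v+1)-2*i = (u+v+1)+1 by omega, show i+v+1-i = v+1 by omega,
        show i+u+(i+v+1)-2*i = u+v+1 by omega, show i+u+1+(i+v)-2*i = u+v+1 by omega,
        show i+v-i=v by omega, Nat.choose_succ_succ]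
      push_cast; ring
    rw [e1, show i+u+1+(i+v+1)-2*i = (u+v+1)+1 by omega,
        show i+u+(i+v+1)-2*i = u+v+1 by omega, show i+u+1+(i+v)-2*i = u+v+1 by omega, hs]
    simp only [map_smul]
    module

noncomputable def W (K p q : ℕ) : PowerSeries ℝ :=
  ∑ i ∈ Finset.range K, (4:ℝ)^i • c p q i • U (p+q-2*i) i
noncomputable def Xx (K p q : ℕ) : PowerSeries ℝ :=
  ∑ i ∈ Finset.range K, (4:ℝ)^i • c p q i • V (p+q-2*i) i

noncomputable def D : PowerSeries ℝ →ₗ[ℝ] PowerSeries ℝ := A ∘ₗ B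
lemma D_app (f) : D f = A (B f) := rfl

lemma c_succ (p q i : ℕ) : c (p+1) (q+1) (i+1) = c p q i := by
  simp only [c, add_le_add_iff_right, show p+1+(q+1)-2*(i+1) = p+q-2*i by omega,
    show q+1-(i+1) = q-i by omega]

lemma c_zero_right (p i : ℕ) : c p 0 i = if i = 0 then 1 else 0 := by
  by_cases h : i = 0 <;> simp [c, h]

lemma c_comm (p q i : ℕ) : c p q i = c q p i := by
  by_cases h : i ≤ p ∧ i ≤ q
  · rw [c, if_pos h, c, if_pos h.symm, add_comm q p]
    rw [Nat.choose_symm_of_eq_add (by omega : p+q-2*i = (q-i)+(p-i))]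
  · rw [c, if_neg h, c, if_neg (by tauto)]

lemma W_comm (K p q : ℕ) : W K p q = W K q p := by
  simp only [W, c_comm p q, add_comm p q]
lemma Xx_comm (K p q : ℕ) : Xx K p q = Xx K q p := by
  simp only [Xx, c_comm p q, add_comm p q]

lemma W_zero (K p : ℕ) : W (K+1) p 0 = F p := by
  rw [W, Finset.sum_eq_single 0]
  · simp [c_zero_right, U_zero]
  · intro b _ hb; simp [c_zero_right, hb]
  · simp

lemma Xx_zero (K p : ℕ) : Xx (K+1) p 0 = V p 0 := by
  rw [Xx, Finset.sum_eq_single 0]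
  · simp [c_zero_right]
  · intro b _ hb; simp [c_zero_right, hb]
  · simp

lemma Xx_succ (K p q : ℕ) : Xx K (p+1) (q+1) =
    A (B (Xx K p (q+1))) + A (B (Xx K (p+1) q)) + B (W K (p+1) (q+1)) := by
  simp only [Xx, W, map_sum, ← Finset.sum_add_distrib]
  refine Finset.sum_congr rfl fun i _ => ?_
  rw [pascal D (fun r => V r i) (fun r => B (U r i)) (V_zero i) (fun r => V_succ r i)]
  simp only [map_smul, D_app, smul_add]

lemma W_succ (K p q : ℕ) : W (K+1) (p+1) (q+1) =
    A (B (W (K+1) p (q+1))) + A (B (W (K+1) (p+1) q)) + (4:ℝ) • A (A (B (Xx K p q))) := by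
  simp only [Xx, W, map_sum, Finset.sum_range_succ' _ K, map_add]
  have h0 := pascal D (fun r => U r 0) (fun r => if r = 0 then 1 else 0) (by simp [U_zero, F])
    (fun r => by simp [U_zero, F, D_app]) p q 0
  have hs := fun i => pascal D (fun r => U r (i+1)) (fun r => A (A (B (V r i)))) (U_zero_succ i)
    (fun r => U_succ_succ r i) p q (i+1)
  simp only [h0, hs]
  simp only [smul_add, Finset.sum_add_distrib, map_smul, D_app, c_succ, Finset.smul_sum]
  rw [if_neg (by omega)]
  have : ∀ i, p+1+(q+1)-2*(i+1) = p+q-2*i := fun i => by omega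
  simp only [this, pow_succ', mul_smul, smul_zero]
  abel

theorem key (N : ℕ) : ∀ p q K, p + q = N → min p q ≤ K →
    P p q = W (K+1) p q ∧ H p q = (2:ℝ) • Xx (K+1) p q := by
  induction N using Nat.strong_induction_on with
  | _ N ih =>
  intro p q K hN hK
  have hP : P p q = W (K+1) p q := by
    rcases p with _ | p
    · rw [P_comm, W_comm, W_zero, P_zero]
    rcases q with _ | q
    · rw [W_zero, P_zero]
    obtain ⟨K, rfl⟩ : ∃ K', K = K' + 1 := ⟨K - 1, by omega⟩
    rw [P_succ, W_succ, (ih (p+(q+1)) (by omega) p (q+1) (K+1) rfl (by omega)).1,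
      (ih (p+1+q) (by omega) (p+1) q (K+1) rfl (by omega)).1,
      (ih (p+q) (by omega) p q K rfl (by omega)).2, smul_smul]
    norm_num
  refine ⟨hP, ?_⟩
  have hz : ∀ p, p + 0 = N → H p 0 = (2:ℝ) • Xx (K+1) p 0 := by
    intro p hp
    rcases p with _ | p
    · rw [H_zero_zero, Xx_zero, V_zero, U_zero, P_zero]
    · rw [H_succ_zero, Xx_zero, V_succ, U_zero, P_zero,
        (ih p (by omega) p 0 K rfl (by omega)).2, Xx_zero]
      simp only [map_smul, smul_add]; abel
  rcases p with _ | p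
  · rw [H_comm, Xx_comm]; exact hz q (by omega)
  rcases q with _ | q
  · exact hz _ hN
  rw [H_succ_succ, Xx_succ, hP, (ih (p+(q+1)) (by omega) p (q+1) K rfl (by omega)).2,
      (ih (p+1+q) (by omega) (p+1) q K rfl (by omega)).2]
  simp only [map_smul, smul_add]; abel
end BB
namespace BB
open PowerSeries

lemma L_nonneg (s : List ℕ) : ∀ n, 0 ≤ coeff n (L s) := by
  induction s with
  | nil => intro n; rw [L, coeff_one]; split_ifs <;> norm_num
  | cons a s ih =>
    intro n; rw [L, coeff_mk]; split_ifs
    · rfl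
    · have := Finset.sum_nonneg (fun k (_ : k ∈ Finset.range n) => ih k)
      positivity

open Classical in
noncomputable def zlt (s : List ℕ) (N : ℕ∞) : ENNReal :=
  ∑' k : Fin s.length → ℕ, if StrictAnti k ∧ (∀ i, 0 < k i) ∧ ∀ i, (k i : ℕ∞) < N then
    ∏ i, ENNReal.ofReal (1 / ((k i : ℝ) ^ s.get i)) else 0

lemma strictAnti_cons {l : ℕ} (n : ℕ) (k : Fin l → ℕ) :
    StrictAnti (Fin.cons n k : Fin (l+1) → ℕ) ↔ (∀ i, k i < n) ∧ StrictAnti k := by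
  constructor
  · intro h
    refine ⟨fun i => ?_, fun i j hij => ?_⟩
    · simpa using h (Fin.succ_pos i)
    · simpa using h (Fin.succ_lt_succ_iff.2 hij)
  · rintro ⟨h1, h2⟩ i j hij
    induction i using Fin.cases with
    | zero =>
      induction j using Fin.cases with
      | zero => exact absurd hij (lt_irrefl _)
      | succ j => simpa using h1 j
    | succ i =>
      induction j using Fin.cases with
      | zero => exact absurd hij (Fin.not_lt_zero _)
      | succ j => simpa using h2 (Fin.succ_lt_succ_iff.1 hij)

lemma zlt_cons (a : ℕ) (s : List ℕ) (N : ℕ∞) : zlt (a :: s) N =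
    ∑' n : ℕ, if 0 < n ∧ (n : ℕ∞) < N then ENNReal.ofReal (1 / (n:ℝ)^a) * zlt s n else 0 := by
  classical
  have e := (Fin.consEquiv (fun _ : Fin (s.length + 1) => ℕ)).tsum_eq
    (fun k : Fin (a :: s).length → ℕ => if StrictAnti k ∧ (∀ i, 0 < k i) ∧ ∀ i, (k i : ℕ∞) < N then
    ∏ i, ENNReal.ofReal (1 / ((k i : ℝ) ^ (a :: s).get i)) else 0)
  rw [zlt]
  refine e.symm.trans ?_
  rw [ENNReal.tsum_prod']
  refine tsum_congr fun n => ?_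
  rw [zlt]
  split_ifs with h
  · rw [← ENNReal.tsum_mul_left]
    refine tsum_congr fun k => ?_
    have hiff : (StrictAnti (Fin.cons n k : Fin (s.length+1) → ℕ) ∧
        (∀ i, 0 < (Fin.cons n k : Fin (s.length+1) → ℕ) i) ∧
        ∀ i, ((Fin.cons n k : Fin (s.length+1) → ℕ) i : ℕ∞) < N) ↔
        (StrictAnti k ∧ (∀ i, 0 < k i) ∧ ∀ i, (k i : ℕ∞) < (n:ℕ∞)) := by
      rw [strictAnti_cons, Fin.forall_fin_succ, Fin.forall_fin_succ]
      simp only [Fin.cons_zero, Fin.cons_succ, Nat.cast_lt]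
      constructor
      · tauto
      · rintro ⟨h1, h2, h3⟩
        exact ⟨⟨h3, h1⟩, ⟨h.1, h2⟩, h.2, fun i => lt_trans (by exact_mod_cast h3 i) h.2⟩
    by_cases hk : (StrictAnti k ∧ (∀ i, 0 < k i) ∧ ∀ i, (k i : ℕ∞) < (n:ℕ∞))
    · rw [if_pos hk]
      refine (if_pos (hiff.2 hk)).trans ?_
      exact Fin.prod_univ_succ (n := s.length) _
    · rw [if_neg hk, mul_zero]
      exact if_neg (fun h => hk (hiff.1 h))
  · rw [ENNReal.tsum_eq_zero]
    intro k
    refine if_neg ?_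
    rintro ⟨_, h1, h2⟩
    exact h ⟨h1 0, h2 0⟩

lemma zlt_nil (N : ℕ∞) : zlt [] N = 1 := by
  classical
  rw [zlt, tsum_eq_single (fun i : Fin ([] : List ℕ).length => Fin.elim0 i)]
  · rw [if_pos]
    · rfl
    · exact ⟨fun i => Fin.elim0 i, fun i => Fin.elim0 i, fun i => Fin.elim0 i⟩
  · intro b hb
    exact absurd (funext fun i => Fin.elim0 i) hb

lemma zlt_eq (s : List ℕ) : ∀ N : ℕ∞, 0 < N → zlt s N =
    ∑' n : ℕ, if (n : ℕ∞) < N then ENNReal.ofReal (coeff n (L s)) else 0 := by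
  induction s with
  | nil =>
    intro N hN
    rw [zlt_nil, tsum_eq_single 0]
    · simp [hN, L]
    · intro b hb; simp [L, coeff_one, hb]
  | cons a s ih =>
    intro N hN
    rw [zlt_cons]
    refine tsum_congr fun n => ?_
    rcases Nat.eq_zero_or_pos n with rfl | hn
    · simp [L]
    · simp only [hn, true_and]
      split_ifs with h
      · rw [ih n (by exact_mod_cast hn), L, coeff_mk, if_neg hn.ne', ENNReal.ofReal_mul (by positivity),
          ENNReal.ofReal_sum_of_nonneg (fun i _ => L_nonneg s i)]
        congr 1
        rw [tsum_eq_sum (s := Finset.range n)]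
        · refine Finset.sum_congr rfl fun k hk => ?_
          rw [if_pos]; exact_mod_cast Finset.mem_range.1 hk
        · intro b hb
          rw [if_neg]; simpa using hb
      · rfl

noncomputable def E (f : PowerSeries ℝ) : ENNReal := ∑' n : ℕ, ENNReal.ofReal (coeff n f)

lemma mzv_eq (s : List ℕ) : mzv s = (E (L s)).toReal := by
  classical
  have h := zlt_eq s ⊤ (by simp)
  have h2 : E (L s) = zlt s ⊤ := by rw [h]; simp [E]
  rw [h2, zlt, mzv]
  have e := tsum_subtype {k : Fin s.length → ℕ | StrictAnti k ∧ ∀ i, 0 < k i}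
    (fun k => ∏ i, 1 / ((k i : ℝ) ^ s.get i))
  refine e.trans ?_
  rw [ENNReal.tsum_toReal_eq]
  · refine tsum_congr fun k => ?_
    by_cases hk : StrictAnti k ∧ ∀ i, 0 < k i
    · rw [Set.indicator_of_mem (by exact hk), if_pos (by simpa using hk), ENNReal.toReal_prod]
      refine Finset.prod_congr rfl fun i _ => ?_
      rw [ENNReal.toReal_ofReal (by positivity)]
    · rw [Set.indicator_of_notMem (by exact hk), if_neg (by simpa using hk)]; rfl
  · intro k
    split_ifs
    · exact (ENNReal.prod_lt_top (fun _ _ => ENNReal.ofReal_lt_top)).ne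
    · simp

lemma E_add (f g : PowerSeries ℝ) (hf : ∀ n, 0 ≤ coeff n f) (hg : ∀ n, 0 ≤ coeff n g) :
    E (f + g) = E f + E g := by
  rw [E, E, E, ← ENNReal.tsum_add]
  refine tsum_congr fun n => ?_
  rw [map_add, ENNReal.ofReal_add (hf n) (hg n)]

lemma E_zero : E 0 = 0 := by simp [E]

lemma E_smul (r : ℝ) (hr : 0 ≤ r) (f : PowerSeries ℝ) : E (r • f) = ENNReal.ofReal r * E f := by
  rw [E, E, ← ENNReal.tsum_mul_left]
  refine tsum_congr fun n => ?_
  rw [map_smul, smul_eq_mul, ENNReal.ofReal_mul hr]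

lemma nonneg_sum {ι : Type*} (s : Finset ι) (f : ι → PowerSeries ℝ)
    (hf : ∀ i ∈ s, ∀ n, 0 ≤ coeff n (f i)) (n : ℕ) : 0 ≤ coeff n (∑ i ∈ s, f i) := by
  rw [map_sum]; exact Finset.sum_nonneg fun i hi => hf i hi n

lemma E_sum {ι : Type*} (s : Finset ι) (f : ι → PowerSeries ℝ)
    (hf : ∀ i ∈ s, ∀ n, 0 ≤ coeff n (f i)) : E (∑ i ∈ s, f i) = ∑ i ∈ s, E (f i) := by
  unfold E
  rw [← Summable.tsum_finsetSum (fun _ _ => ENNReal.summable)]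
  refine tsum_congr fun n => ?_
  rw [map_sum, ENNReal.ofReal_sum_of_nonneg (fun i hi => hf i hi n)]

lemma E_mul (f g : PowerSeries ℝ) (hf : ∀ n, 0 ≤ coeff n f) (hg : ∀ n, 0 ≤ coeff n g) :
    E (f * g) = E f * E g := by
  unfold E
  rw [← ENNReal.tsum_mul_right]
  simp_rw [← ENNReal.tsum_mul_left]
  rw [← ENNReal.tsum_prod (f := fun a b => ENNReal.ofReal (coeff a f) * ENNReal.ofReal (coeff b g)),
    ← Finset.HasAntidiagonal.sigmaAntidiagonalEquivProd.tsum_eq, ENNReal.tsum_sigma']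
  refine tsum_congr fun n => ?_
  rw [coeff_mul, ENNReal.ofReal_sum_of_nonneg (fun i _ => mul_nonneg (hf _) (hg _)), tsum_fintype]
  rw [← Finset.sum_coe_sort]
  refine Finset.sum_congr rfl fun x _ => ?_
  rw [ENNReal.ofReal_mul (hf _)]
  rfl

lemma list_nonneg (l : List (List ℕ)) (n : ℕ) : 0 ≤ coeff n ((l.map L).sum) := by
  induction l with
  | nil => simp
  | cons a l ih => simp only [List.map_cons, List.sum_cons, map_add]; exact add_nonneg (L_nonneg a n) ih

lemma list_E (l : List (List ℕ)) (h : E ((l.map L).sum) ≠ ⊤) :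
    (E ((l.map L).sum)).toReal = (l.map mzv).sum := by
  induction l with
  | nil => simp [E_zero]
  | cons a l ih =>
    simp only [List.map_cons, List.sum_cons] at *
    rw [E_add _ _ (L_nonneg a) (list_nonneg l)] at *
    rw [ENNReal.add_ne_top] at h
    rw [ENNReal.toReal_add h.1 h.2, ih h.2, mzv_eq]

lemma U_E (r j : ℕ) (h : E (U r j) ≠ ⊤) : (E (U r j)).toReal =
    zetaShuffle (List.replicate r 2) (ls31 j) := list_E _ h

lemma F_eq (p : ℕ) : F p = L (List.replicate p 2) := by
  induction p with
  | zero => rfl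
  | succ p ih => rw [List.replicate_succ, L_two, ← ih]; rfl

lemma F_nonneg (p : ℕ) : ∀ n, 0 ≤ coeff n (F p) := by rw [F_eq]; exact L_nonneg _

lemma c_nonneg (p q i : ℕ) : 0 ≤ c p q i := by unfold c; split_ifs <;> positivity

lemma prod_formula (hfin : ∀ p, E (F p) ≠ ⊤) (p q K : ℕ) (hK : min p q ≤ K) :
    (E (F p)).toReal * (E (F q)).toReal =
    ∑ i ∈ Finset.range (K+1), 4^i * (c p q i * zetaShuffle (List.replicate (p+q-2*i) 2) (ls31 i)) := by
  have h := (key (p+q) p q K rfl hK).1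
  have hU : ∀ i n, 0 ≤ coeff n (U (p+q-2*i) i) := fun i n => list_nonneg _ n
  have hne : E (P p q) ≠ ⊤ := by
    rw [P, E_mul _ _ (F_nonneg p) (F_nonneg q)]; exact ENNReal.mul_ne_top (hfin p) (hfin q)
  have e1 : E (P p q) = ∑ i ∈ Finset.range (K+1),
      ENNReal.ofReal (4^i) * (ENNReal.ofReal (c p q i) * E (U (p+q-2*i) i)) := by
    rw [h, W, E_sum]
    · refine Finset.sum_congr rfl fun i _ => ?_
      rw [E_smul _ (by positivity), E_smul _ (c_nonneg _ _ _)]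
    · intro i _ n
      rw [map_smul, map_smul, smul_eq_mul, smul_eq_mul]
      have := c_nonneg p q i
      have := hU i n
      positivity
  rw [← ENNReal.toReal_mul, ← E_mul _ _ (F_nonneg p) (F_nonneg q)]
  change (E (P p q)).toReal = _
  rw [e1] at hne ⊢
  rw [ENNReal.sum_ne_top] at hne
  rw [ENNReal.toReal_sum hne]
  refine Finset.sum_congr rfl fun i hi => ?_
  rw [ENNReal.toReal_mul, ENNReal.toReal_mul, ENNReal.toReal_ofReal (by positivity),
    ENNReal.toReal_ofReal (c_nonneg _ _ _)]
  congr 1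
  rcases eq_or_ne (c p q i) 0 with h0 | h0
  · simp [h0]
  · congr 1
    apply U_E
    intro htop
    apply hne i hi
    rw [htop, ENNReal.mul_top, ENNReal.mul_top]
    · simp
    · simpa using (c_nonneg p q i).lt_of_ne' h0
end BB
namespace BB
open PowerSeries Filter Topology

noncomputable def e (p N : ℕ) : ℝ := ∑ k ∈ Finset.range N, coeff k (F p)

lemma e_zero (N : ℕ) : e 0 (N+1) = 1 := by
  simp [e, F, coeff_one]

lemma e_succ_one (p : ℕ) : e (p+1) 1 = 0 := by
  simp [e, F, cA]

lemma e_succ (p N : ℕ) : e (p+1) (N+1+1) = e (p+1) (N+1) + e p (N+1) / ((N:ℝ)+1)^2 := by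
  have : coeff (N+1) (F (p+1)) = e p (N+1) / ((N:ℝ)+1)^2 := by
    rw [F, coeff_A, coeff_B, e, div_div, sq]; push_cast; rfl
  rw [e, Finset.sum_range_succ, this]; rfl

lemma e_nonneg (p N : ℕ) : 0 ≤ e p N := Finset.sum_nonneg fun k _ => F_nonneg p k

lemma hasSum_e (t : ℝ) (N : ℕ) : HasSum (fun p => e p (N+1) * t^p)
    (∏ j ∈ Finset.range N, (1 + t / ((j:ℝ)+1)^2)) := by
  induction N with
  | zero =>
    have : (fun p => e p (0+1) * t^p) = fun p => if p = 0 then 1 else 0 := by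
      funext p; cases p with
      | zero => simp [e_zero]
      | succ p => simp [e_succ_one]
    rw [this]
    simpa using hasSum_ite_eq (0:ℕ) (1:ℝ)
  | succ N ih =>
    rw [Finset.prod_range_succ, mul_add, mul_one]
    have h2 : HasSum (fun p => if p = 0 then 0 else e (p-1) (N+1) * t^(p-1) * (t / ((N:ℝ)+1)^2))
        ((∏ j ∈ Finset.range N, (1 + t / ((j:ℝ)+1)^2)) * (t / ((N:ℝ)+1)^2)) := by
      rw [← hasSum_nat_add_iff' 1]
      simpa using ih.mul_right (t / ((N:ℝ)+1)^2)
    convert ih.add h2 using 1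
    funext p
    cases p with
    | zero => simp [e_zero]
    | succ p => rw [e_succ, if_neg (by omega), Nat.add_sub_cancel, pow_succ]; ring

lemma prod_bound : ∃ C : ℝ, 0 ≤ C ∧ ∀ N, ∏ j ∈ Finset.range N, (1 + (4:ℝ) / ((j:ℝ)+1)^2) ≤ C := by
  have hs : Summable (fun j : ℕ => (4:ℝ) / ((j:ℝ)+1)^2) := by
    have := (summable_nat_add_iff 1).2 (Real.summable_nat_pow_inv.2 (by norm_num : 1 < 2))
    simpa [div_eq_mul_inv] using this.mul_left 4
  refine ⟨Real.exp (∑' j : ℕ, (4:ℝ) / ((j:ℝ)+1)^2), (Real.exp_pos _).le, fun N => ?_⟩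
  calc _ ≤ ∏ j ∈ Finset.range N, Real.exp ((4:ℝ) / ((j:ℝ)+1)^2) := by
        refine Finset.prod_le_prod (fun _ _ => by positivity) fun j _ => ?_
        rw [add_comm]; exact Real.add_one_le_exp _
    _ = Real.exp (∑ j ∈ Finset.range N, (4:ℝ) / ((j:ℝ)+1)^2) := (Real.exp_sum _ _).symm
    _ ≤ _ := Real.exp_le_exp.2 (hs.sum_le_tsum _ fun _ _ => by positivity)

lemma e_bound : ∃ C : ℝ, 0 ≤ C ∧ ∀ p N, e p (N+1) ≤ C * (1/4)^p := by
  obtain ⟨C, h0, hC⟩ := prod_bound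
  refine ⟨C, h0, fun p N => ?_⟩
  have h := le_hasSum (hasSum_e 4 N) p (fun q _ => mul_nonneg (e_nonneg _ _) (by positivity))
  have h' := h.trans (hC N)
  rw [one_div, inv_pow, ← div_eq_mul_inv, le_div_iff₀ (by positivity)]
  exact h'

lemma F_summable (p : ℕ) : Summable (fun k => coeff k (F p)) := by
  obtain ⟨C, h0, hC⟩ := e_bound
  refine summable_of_sum_range_le (c := C * (1/4)^p) (F_nonneg p) fun n => ?_
  refine le_trans ?_ (hC p n)
  exact Finset.sum_le_sum_of_subset_of_nonneg (Finset.range_mono (Nat.le_succ n)) fun k _ _ => F_nonneg p k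

noncomputable def z (p : ℕ) : ℝ := ∑' k, coeff k (F p)

lemma E_F (p : ℕ) : E (F p) = ENNReal.ofReal (z p) := by
  rw [E, z, ENNReal.ofReal_tsum_of_nonneg (F_nonneg p) (F_summable p)]

lemma z_nonneg (p : ℕ) : 0 ≤ z p := tsum_nonneg (F_nonneg p)

lemma tendsto_e (p : ℕ) : Tendsto (fun N => e p (N+1)) atTop (𝓝 (z p)) :=
  (tendsto_add_atTop_iff_nat 1).2 (F_summable p).hasSum.tendsto_sum_nat

lemma z_bound : ∃ C : ℝ, 0 ≤ C ∧ ∀ p, z p ≤ C * (1/4)^p := by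
  obtain ⟨C, h0, hC⟩ := e_bound
  exact ⟨C, h0, fun p => le_of_tendsto' (tendsto_e p) (hC p)⟩

lemma tendsto_prod (t : ℝ) (ht : |t| ≤ 1) :
    Tendsto (fun N => ∏ j ∈ Finset.range N, (1 + t / ((j:ℝ)+1)^2)) atTop (𝓝 (∑' p, z p * t^p)) := by
  obtain ⟨C, h0, hC⟩ := e_bound
  simp_rw [← fun N => (hasSum_e t N).tsum_eq]
  refine tendsto_tsum_of_dominated_convergence (bound := fun p => C * (1/4)^p) ?_ ?_ ?_
  · exact (summable_geometric_of_lt_one (by norm_num) (by norm_num)).mul_left C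
  · intro p; exact (tendsto_e p).mul_const _
  · refine Eventually.of_forall fun N p => ?_
    rw [norm_mul, norm_pow, Real.norm_eq_abs, Real.norm_eq_abs, abs_of_nonneg (e_nonneg _ _)]
    calc _ ≤ e p (N+1) * 1 := by
          gcongr
          · exact e_nonneg _ _
          · exact pow_le_one₀ (abs_nonneg _) ht
      _ ≤ _ := by rw [mul_one]; exact hC p N

lemma z_summable (t : ℝ) (ht : |t| ≤ 1) : Summable (fun p => z p * t^p) := by
  obtain ⟨C, h0, hC⟩ := z_bound
  refine Summable.of_norm_bounded (g := fun p => C * (1/4)^p)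
    ((summable_geometric_of_lt_one (by norm_num) (by norm_num)).mul_left C) fun p => ?_
  rw [norm_mul, norm_pow, Real.norm_eq_abs, Real.norm_eq_abs, abs_of_nonneg (z_nonneg _)]
  calc _ ≤ z p * 1 := by
        gcongr
        · exact z_nonneg _
        · exact pow_le_one₀ (abs_nonneg _) ht
    _ ≤ _ := by rw [mul_one]; exact hC p

lemma uniq (d : ℕ → ℝ) (M : ℝ) (hM : ∀ p, |d p| ≤ M)
    (h : ∀ x : ℝ, 0 < x → x ≤ 1/2 → HasSum (fun p => d p * (-x)^p) 0) : ∀ n, d n = 0 := by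
  intro n
  induction n using Nat.strong_induction_on with
  | _ n ih =>
  have hM0 : 0 ≤ M := (abs_nonneg _).trans (hM 0)
  have key : ∀ x : ℝ, 0 < x → x ≤ 1/2 → |d n| ≤ 2 * M * x := by
    intro x hx hx2
    have h1 := (hasSum_nat_add_iff' (n+1)).2 (h x hx hx2)
    have h2 : ∑ i ∈ Finset.range (n+1), d i * (-x)^i = d n * (-x)^n := by
      rw [Finset.sum_range_succ, Finset.sum_eq_zero, zero_add]
      intro i hi; rw [ih i (Finset.mem_range.1 hi), zero_mul]
    rw [h2, zero_sub] at h1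
    have h3 : HasSum (fun p : ℕ => M * x^(n+1) * (1/2:ℝ)^p) (M * x^(n+1) * 2) :=
      hasSum_geometric_two.mul_left _
    have h4 := tsum_of_norm_bounded (f := fun p => d (p + (n+1)) * (-x)^(p+(n+1))) h3 (fun p => by
      rw [norm_mul, norm_pow, norm_neg, Real.norm_eq_abs, Real.norm_eq_abs, abs_of_pos hx, pow_add,
        mul_comm (x^p), ← mul_assoc]
      gcongr
      exact hM _)
    rw [h1.tsum_eq, norm_neg, norm_mul, norm_pow, norm_neg, Real.norm_eq_abs, Real.norm_eq_abs,
      abs_of_pos hx] at h4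
    have hxn : 0 < x^n := by positivity
    refine le_of_mul_le_mul_right ?_ hxn
    calc _ ≤ _ := h4
      _ = _ := by ring
  by_contra hne
  have hpos : 0 < |d n| := abs_pos.2 hne
  have hx := key (min (1/2) (|d n| / (4 * M + 1))) (by positivity) (min_le_left _ _)
  have h5 : 2 * M * min (1/2) (|d n| / (4 * M + 1)) ≤ 2 * M * (|d n| / (4 * M + 1)) := by
    gcongr; exact min_le_right _ _
  have h6 : 2 * M * (|d n| / (4 * M + 1)) < |d n| := by
    rw [mul_div_assoc', div_lt_iff₀ (by positivity)]; nlinarith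
  linarith

lemma pi_summand_bound : ∃ C : ℝ, ∀ p : ℕ, Real.pi^(2*p) / ((2*p+1).factorial : ℝ) ≤ C := by
  refine ⟨Real.exp Real.pi, fun p => ?_⟩
  calc _ ≤ Real.pi^(2*p) / ((2*p).factorial : ℝ) := by
        gcongr; omega
    _ ≤ _ := Real.pow_div_factorial_le_exp _ Real.pi_pos.le _

lemma z_eq (p : ℕ) : z p = Real.pi^(2*p) / ((2*p+1).factorial : ℝ) := by
  obtain ⟨C, h0, hC⟩ := z_bound
  obtain ⟨C', hC'⟩ := pi_summand_bound
  refine sub_eq_zero.1 (uniq (fun p => z p - Real.pi^(2*p) / ((2*p+1).factorial : ℝ)) (C + C') ?_ ?_ p)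
  · intro p
    have h1 : z p ≤ C := (hC p).trans (mul_le_of_le_one_right h0 (pow_le_one₀ (by norm_num) (by norm_num)))
    have h2 := hC' p
    have h3 := z_nonneg p
    have h4 : 0 ≤ Real.pi^(2*p) / ((2*p+1).factorial : ℝ) := by positivity
    rw [abs_le]; constructor <;> linarith
  · intro y hy hy2
    set x := Real.sqrt y with hx
    have hxp : 0 < x := Real.sqrt_pos.2 hy
    have hxy : x^2 = y := Real.sq_sqrt hy.le
    have hz := (z_summable (-y) (by rw [abs_neg, abs_of_pos hy]; linarith)).hasSum
    have ht := (tendsto_prod (-y) (by rw [abs_neg, abs_of_pos hy]; linarith)).const_mul (Real.pi * x)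
    have hs := Real.tendsto_euler_sin_prod x
    have heq := tendsto_nhds_unique ht (by
      refine hs.congr fun N => ?_
      congr 1
      refine Finset.prod_congr rfl fun j _ => ?_
      rw [hxy]; ring)
    have hsin := (Real.hasSum_sin (Real.pi * x)).mul_left (Real.pi * x)⁻¹
    have hne : Real.pi * x ≠ 0 := by positivity
    have hsub := hz.sub hsin
    rw [← heq, inv_mul_cancel_left₀ hne, sub_self] at hsub
    refine Eq.mp (congrArg (fun f => HasSum f 0) (funext fun q => ?_)) hsub
    have e1 : (Real.pi * x)^(2*q+1) = (Real.pi * x) * (Real.pi^(2*q) * y^q) := by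
      rw [pow_succ, mul_pow, pow_mul x, hxy]; ring
    rw [e1, neg_pow y q]
    field_simp
end BB
namespace BB

lemma prod_formula' (p q K : ℕ) (hK : min p q ≤ K) :
    Real.pi^(2*p) / ((2*p+1).factorial : ℝ) * (Real.pi^(2*q) / ((2*q+1).factorial : ℝ)) =
    ∑ i ∈ Finset.range (K+1), 4^i * (c p q i * zetaShuffle (List.replicate (p+q-2*i) 2) (ls31 i)) := by
  rw [← prod_formula (fun p => by rw [E_F]; simp) p q K hK, E_F, E_F,
    ENNReal.toReal_ofReal (z_nonneg _), ENNReal.toReal_ofReal (z_nonneg _), z_eq, z_eq]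

lemma a_vanish (m j : ℕ) (hm : 0 < m) (hj : m < j) :
    ∑ k ∈ Finset.Icc (1 - (j : ℤ)) (j : ℤ),
            (k.negOnePow : ℤ) * k ^ (2 * m - 1) *
              (Nat.choose (2 * j - 1) ((j : ℤ) - k).toNat : ℤ) = 0 := by
  have h := fwdDiff_iter_eq_sum_shift (1:ℤ) (fun x : ℤ => x^(2*m-1)) (2*j-1) (1-(j:ℤ))
  rw [fwdDiff_iter_pow_eq_zero_of_lt (by omega : 2*m-1 < 2*j-1)] at h
  have h2 : ∑ k ∈ Finset.Icc (1 - (j : ℤ)) (j : ℤ),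
            (k.negOnePow : ℤ) * k ^ (2 * m - 1) *
              (Nat.choose (2 * j - 1) ((j : ℤ) - k).toNat : ℤ) =
      (-1)^j * ∑ k ∈ Finset.range (2*j-1+1), ((-1:ℤ) ^ (2*j-1 - k) * ((2*j-1).choose k : ℤ)) •
        (fun x : ℤ => x^(2*m-1)) (1-(j:ℤ) + k • (1:ℤ)) := by
    rw [Finset.mul_sum]
    symm
    refine Finset.sum_bij' (fun (k : ℕ) _ => 1 - (j:ℤ) + k) (fun k _ => (k - (1 - (j:ℤ))).toNat)
      ?_ ?_ ?_ ?_ ?_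
    · intro k hk; rw [Finset.mem_range] at hk; rw [Finset.mem_Icc]; omega
    · intro k hk; rw [Finset.mem_Icc] at hk; rw [Finset.mem_range]; omega
    · intro k hk; simp
    · intro k hk; rw [Finset.mem_Icc] at hk; omega
    · intro k hk; rw [Finset.mem_range] at hk
      have e1 : ((j:ℤ) - (1 - (j:ℤ) + k)).toNat = 2*j-1-k := by omega
      have e2 : (((1 - (j:ℤ) + k).negOnePow : ℤˣ) : ℤ) = (-1)^j * (-1)^(2*j-1-k) := by
        rw [← pow_add]
        have : (-1:ℤ)^(j + (2*j-1-k)) = (((j + (2*j-1-k) : ℕ) : ℤ).negOnePow : ℤˣ) := by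
          rw [Int.negOnePow_def, zpow_natCast, Units.val_pow_eq_pow_val]; simp
        rw [this]
        congr 1
        rw [Int.negOnePow_eq_iff]
        refine ⟨1 - 2*j + k, ?_⟩
        omega
      rw [e1, e2, Nat.choose_symm (by omega)]
      simp only [smul_eq_mul, nsmul_eq_mul, mul_one]
      ring
  rw [h2, ← h]; simp

end BB

/-- For positive integers `n ≥ m`:
`∑_{k=1−n}^{n} (−1)^k k^(2m−1) π^(4n−2) / ((2n+2k−1)!(2n−2k+1)!)
  = ∑_{j=1}^{m} 4^(n−j) ⬝ a_{2m−1,j} ⬝ ζ({2}^(2j−1) ⧢ {3,1}^(n−j))`,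
where `a_{2m−1,j} = ∑_{k=1−j}^{j} (−1)^k k^(2m−1) C(2j−1, j−k)`. -/
theorem zeta_shuffle_recursion_odd (m n : ℕ) (hm : 0 < m) (hmn : m ≤ n) :
    ∑ k ∈ Finset.Icc (1 - (n : ℤ)) (n : ℤ),
      (((k.negOnePow : ℤ) * k ^ (2 * m - 1) : ℤ) : ℝ) * Real.pi ^ (4 * n - 2) /
        ((Nat.factorial (2 * (n : ℤ) + 2 * k - 1).toNat) *
          (Nat.factorial (2 * (n : ℤ) - 2 * k + 1).toNat))
    = ∑ j ∈ Finset.Icc 1 m,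
        (4 : ℝ) ^ (n - j) *
          ((∑ k ∈ Finset.Icc (1 - (j : ℤ)) (j : ℤ),
            (k.negOnePow : ℤ) * k ^ (2 * m - 1) *
              (Nat.choose (2 * j - 1) ((j : ℤ) - k).toNat : ℤ) : ℤ) : ℝ) *
          zetaShuffle (List.replicate (2 * j - 1) 2)
            (List.flatten (List.replicate (n - j) [3, 1])) := by
  have hext : ∀ G : ℕ → ℝ, (∀ j, m < j → G j = 0) →
      ∑ j ∈ Finset.Icc 1 m, G j = ∑ j ∈ Finset.Icc 1 n, G j := by
    intro G hG
    refine Finset.sum_subset (Finset.Icc_subset_Icc_right hmn) ?_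
    intro j hj hj'
    rw [Finset.mem_Icc] at hj hj'
    exact hG j (by omega)
  rw [hext _ (fun j hj => by rw [BB.a_vanish m j hm hj]; simp)]
  have hR : ∀ j ∈ Finset.Icc 1 n, (4 : ℝ) ^ (n - j) *
          ((∑ k ∈ Finset.Icc (1 - (j : ℤ)) (j : ℤ),
            (k.negOnePow : ℤ) * k ^ (2 * m - 1) *
              (Nat.choose (2 * j - 1) ((j : ℤ) - k).toNat : ℤ) : ℤ) : ℝ) *
          zetaShuffle (List.replicate (2 * j - 1) 2)
            (List.flatten (List.replicate (n - j) [3, 1])) =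
      ∑ k ∈ Finset.Icc (1 - (n : ℤ)) (n : ℤ), (((k.negOnePow : ℤ) * k ^ (2 * m - 1) : ℤ) : ℝ) *
        (4 ^ (n-j) * (BB.c (n + k - 1).toNat (n - k).toNat (n-j) *
          zetaShuffle (List.replicate (2 * j - 1) 2) (BB.ls31 (n-j)))) := by
    intro j hj
    rw [Finset.mem_Icc] at hj
    rw [Int.cast_sum, Finset.mul_sum, Finset.sum_mul]
    symm
    rw [← Finset.sum_subset (s₁ := Finset.Icc (1 - (j : ℤ)) (j : ℤ))]
    · refine Finset.sum_congr rfl fun k hk => ?_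
      rw [Finset.mem_Icc] at hk
      rw [BB.c, if_pos (by omega),
        show (n + k - 1).toNat + (n - k).toNat - 2 * (n-j) = 2 * j - 1 by omega,
        show (n - k).toNat - (n-j) = ((j:ℤ)-k).toNat by omega, BB.ls31]
      push_cast
      ring
    · exact Finset.Icc_subset_Icc (by omega) (by omega)
    · intro k hk hk'
      rw [Finset.mem_Icc] at hk hk'
      rw [BB.c, if_neg (by omega)]
      simp
  rw [Finset.sum_congr rfl hR, Finset.sum_comm]
  refine Finset.sum_congr rfl fun k hk => ?_
  rw [Finset.mem_Icc] at hk
  rw [← Finset.mul_sum]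
  obtain ⟨K, rfl⟩ : ∃ K, n = K + 1 := ⟨n - 1, by omega⟩
  have hpf := BB.prod_formula' (((K+1:ℕ):ℤ) + k - 1).toNat (((K+1:ℕ):ℤ) - k).toNat K (by omega)
  have e1 : 2 * (((K+1:ℕ):ℤ) + k - 1).toNat + 1 = (2 * ((K+1:ℕ):ℤ) + 2 * k - 1).toNat := by omega
  have e2 : 2 * (((K+1:ℕ):ℤ) - k).toNat + 1 = (2 * ((K+1:ℕ):ℤ) - 2 * k + 1).toNat := by omega
  have e3 : 4 * (K+1) - 2 = 2 * (((K+1:ℕ):ℤ) + k - 1).toNat + 2 * (((K+1:ℕ):ℤ) - k).toNat := by omega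
  rw [mul_div_assoc, ← e1, ← e2, e3, pow_add, mul_div_mul_comm, hpf]
  congr 1
  refine Finset.sum_bij' (fun i _ => K + 1 - i) (fun j _ => K + 1 - j) ?_ ?_ ?_ ?_ ?_
  · intro i hi; rw [Finset.mem_range] at hi; rw [Finset.mem_Icc]; omega
  · intro i hi; rw [Finset.mem_Icc] at hi; rw [Finset.mem_range]; omega
  · intro i hi; rw [Finset.mem_range] at hi; omega
  · intro i hi; rw [Finset.mem_Icc] at hi; omega
  · intro i hi
    rw [Finset.mem_range] at hi
    rw [show K + 1 - (K + 1 - i) = i by omega,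
      show (((K+1:ℕ):ℤ) + k - 1).toNat + (((K+1:ℕ):ℤ) - k).toNat - 2 * i = 2 * (K+1-i) - 1 by omega]
end
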